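/- arXiv:2209.00864 — 3 statements merged into one kernel-verified Lean document; each statement's English description precedes it below -/
import Mathlib

section
/- Let $d>1$ be an integer, let $q$ be a power of an odd prime, and let $n \geq 2$ be an integer such that $q^n \equiv 1 \pmod{2d}$ and $q > (n-1)^2$. If the subfield $\mathbb{F}_q$ of $\mathbb{F}_{q^n}$ is a maximal subfield clique in the $d$-Paley graph $GP(q^n, d)$, then $\mathbb{F}_q$ is also a maximal clique in $GP(q^n, d)$. -/
open Polynomial

lemma sum_pow_aux {k ι : Type*} [Field k] (p e s : ℕ) [Fact p.Prime] [CharP k p]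
    (hs : s = p ^ e) (S : Finset ι) (f : ι → k) : (∑ i ∈ S, f i) ^ s = ∑ i ∈ S, f i ^ s := by
  subst hs; exact sum_pow_char_pow p e S f

lemma stepanov_bound {k : Type*} [Field k] [Fintype k] [DecidableEq k] (p e : ℕ) [Fact p.Prime] [CharP k p]
    (s l e0 : ℕ) (hs : s = p ^ e) (hs3 : 3 ≤ s) (hcard : Fintype.card k = s ^ 2)
    (hl : l * e0 = s - 1) (g g1 : k[X]) (hg : g = X * g1) (hg1 : g1.eval 0 ≠ 0)
    (ζ : k) (hζ : ζ ≠ 0) :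
    (Finset.univ.filter (fun a : k => (g.eval a) ^ (e0 * (s + 1)) = ζ)).card
      ≤ e0 * s + (3 * g.natDegree + 5) * s := by
  classical
  set D := g.natDegree with hD
  have hle : 0 < e0 := by
    rcases Nat.eq_zero_or_pos e0 with h | h
    · subst h; omega
    · exact h
  have hle1 : 1 ≤ l := by
    rcases Nat.eq_zero_or_pos l with h | h
    · subst h; omega
    · exact h
  have he0s : e0 ≤ s - 1 := by nlinarith
  have hg1ne : g1 ≠ 0 := by rintro rfl; simp at hg1
  have hD1 : g1.natDegree + 1 = D := by
    rw [hD, hg, natDegree_X_mul hg1ne]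
  obtain ⟨J, hJ⟩ : ∃ J, J = e0 + 2 * D + 5 := ⟨_, rfl⟩
  obtain ⟨B, hB⟩ : ∃ B, B = e0 * s + J + (s - 1) * D := ⟨_, rfl⟩
  have hdiv : ∀ w : Fin (s-1), (w : ℕ) / e0 < l := fun w => by
    rw [Nat.div_lt_iff_lt_mul hle, hl]; exact w.2
  let ψ : (Fin J × Fin (s-1)) → k[X] := fun x =>
    C (ζ ^ ((x.2 : ℕ) / e0)) * X ^ (((x.2 : ℕ) % e0) * s + (x.1 : ℕ)) * g ^ ((l - (x.2 : ℕ) / e0) * e0)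
  have hψ : ∀ x, ψ x ∈ degreeLT k B := by
    intro x
    rw [mem_degreeLT]
    refine lt_of_le_of_lt degree_le_natDegree ?_
    norm_cast
    have h1 : (ψ x).natDegree ≤ ((x.2 : ℕ) % e0) * s + (x.1 : ℕ) + ((l - (x.2 : ℕ) / e0) * e0) * D := by
      refine natDegree_mul_le.trans (add_le_add (natDegree_C_mul_X_pow_le _ _) natDegree_pow_le)
    have h2 : ((l - (x.2 : ℕ) / e0) * e0) ≤ s - 1 := by
      exact (Nat.mul_le_mul_right _ (Nat.sub_le _ _)).trans hl.le
    have h3 := Nat.mul_le_mul_right D h2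
    have h4 : ((x.2 : ℕ) % e0) * s ≤ e0 * s := Nat.mul_le_mul_right _ (Nat.mod_lt _ hle).le
    have := x.1.2
    omega
  let Φ : ((Fin J × Fin (s-1)) → k) →ₗ[k] degreeLT k B :=
    Fintype.linearCombination k (fun x => (⟨ψ x, hψ x⟩ : degreeLT k B))
  have hfin : Module.finrank k (degreeLT k B) < Module.finrank k ((Fin J × Fin (s-1)) → k) := by
    rw [(degreeLTEquiv k B).finrank_eq]
    simp only [Module.finrank_fintype_fun_eq_card, Fintype.card_fin, Fintype.card_prod]
    obtain ⟨t, rfl⟩ : ∃ t, s = t + 3 := ⟨s - 3, by omega⟩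
    have : t + 3 - 1 = t + 2 := by omega
    rw [this] at he0s hB ⊢
    rw [hB, hJ]
    nlinarith
  obtain ⟨u, hu, hu0⟩ := (Submodule.ne_bot_iff _).1 (LinearMap.ker_ne_bot_of_finrank_lt (f := Φ) hfin)
  have hW : ∑ x, u x • ψ x = 0 := by
    have := congrArg (Submodule.subtype _) (LinearMap.mem_ker.1 hu)
    simpa [Φ, Fintype.linearCombination_apply] using this
  let τ : (Fin J × Fin (s-1)) → ℕ := fun x => (x.2 : ℕ) + (x.1 : ℕ) * s
  have hτ : Function.Injective τ := by
    rintro ⟨j, w⟩ ⟨j', w'⟩ h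
    simp only [τ] at h
    have hw := w.2
    have hw' := w'.2
    have h1 : (w : ℕ) = w' := by
      have := congrArg (· % s) h
      simpa [Nat.mod_eq_of_lt (show (w:ℕ) < s by omega), Nat.mod_eq_of_lt (show (w':ℕ) < s by omega)] using this
    have h2 : (j : ℕ) = j' := by
      rw [h1] at h
      exact Nat.eq_of_mul_eq_mul_right (by omega : 0 < s) (Nat.add_left_cancel h)
    ext <;> assumption
  let U : k[X] := ∑ x, C (u x ^ s) * X ^ (τ x) * g1 ^ (((x.2 : ℕ) / e0) * e0)
  have hU0 : U ≠ 0 := by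
    obtain ⟨x0, hx0⟩ := Function.ne_iff.1 hu0
    obtain ⟨x, hx, hmin⟩ := Finset.exists_min_image (Finset.univ.filter (fun x => u x ≠ 0)) τ
      ⟨x0, by simpa using hx0⟩
    simp only [Finset.mem_filter, Finset.mem_univ, true_and] at hx hmin
    intro h
    have hc : U.coeff (τ x) = u x ^ s * (g1.eval 0) ^ (((x.2 : ℕ) / e0) * e0) := by
      simp only [U, finsetSum_coeff]
      rw [Finset.sum_eq_single x]
      · rw [mul_assoc, coeff_C_mul, coeff_X_pow_mul', if_pos le_rfl, Nat.sub_self, coeff_zero_eq_eval_zero,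
          eval_pow]
      · intro y _ hy
        by_cases huy : u y = 0
        · simp [huy, show s ≠ 0 by omega]
        · rw [mul_assoc, coeff_C_mul, coeff_X_pow_mul', if_neg, mul_zero]
          have := hmin y huy
          have := hτ.ne hy
          omega
      · simp
    rw [h, coeff_zero] at hc
    exact mul_ne_zero (pow_ne_zero _ hx) (pow_ne_zero _ hg1) hc.symm
  have hUdeg : U.natDegree ≤ e0 * s + (3 * D + 5) * s := by
    refine natDegree_sum_le_of_forall_le _ _ fun x _ => ?_
    refine (natDegree_mul_le.trans (add_le_add (natDegree_C_mul_X_pow_le _ _) natDegree_pow_le)).trans ?_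
    have h2 : ((x.2 : ℕ) / e0) * e0 ≤ s := (Nat.div_mul_le_self _ _).trans (by omega)
    have h3 := Nat.mul_le_mul h2 (show g1.natDegree ≤ D by omega)
    have h4 : (x.1 : ℕ) * s ≤ (e0 + 2 * D + 4) * s := Nat.mul_le_mul_right _ (by omega)
    have h5 : (x.2 : ℕ) ≤ s := by have := x.2.2; omega
    simp only [τ]
    nlinarith
  refine le_trans ?_ hUdeg
  refine le_trans ?_ (card_roots' U)
  refine le_trans (Finset.card_le_card ?_) (Multiset.toFinset_card_le _)
  intro a ha
  simp only [Finset.mem_filter, Finset.mem_univ, true_and] at ha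
  rw [Multiset.mem_toFinset, mem_roots hU0, IsRoot.def]
  have hga : g.eval a ≠ 0 := by
    intro h; rw [h, zero_pow (by positivity)] at ha; exact hζ ha.symm
  have haQ : ∀ b : k, (b ^ s) ^ s = b := fun b => by
    rw [← pow_mul, ← sq, ← hcard, FiniteField.pow_card]
  have key : (U.eval a) ^ s * (g.eval a) ^ (l * e0) = 0 := by
    have h0 := congrArg (eval a) hW
    rw [eval_zero, eval_finsetSum] at h0
    rw [← h0]
    simp only [U, eval_finsetSum]
    rw [sum_pow_aux p e s hs, Finset.sum_mul]
    refine Finset.sum_congr rfl fun x _ => ?_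
    obtain ⟨j, w⟩ := x
    simp only [ψ, τ, eval_mul, eval_C, eval_pow, eval_X, eval_smul, smul_eq_mul]
    have hx : eval a g = a * eval a g1 := by rw [hg]; simp
    have e1 : a ^ ((w : ℕ) + j * s) * eval a g1 ^ ((w : ℕ) / e0 * e0)
        = a ^ ((w : ℕ) % e0) * (eval a g) ^ ((w : ℕ) / e0 * e0) * (a ^ s) ^ (j : ℕ) := by
      rw [hx, mul_pow, ← pow_mul]
      nth_rewrite 1 [← Nat.mod_add_div' (w : ℕ) e0]
      ring
    rw [mul_assoc (u (j, w) ^ s), e1, mul_pow, haQ, mul_pow, mul_pow, ← pow_mul, pow_right_comm (a ^ s), haQ]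
    have hi := hdiv w
    obtain ⟨r, hr⟩ : ∃ r, l = (w : ℕ) / e0 + r := ⟨l - (w : ℕ) / e0, by omega⟩
    have hr' : l - (w : ℕ) / e0 = r := by omega
    rw [hr', ← ha]
    generalize (w : ℕ) / e0 = i at *
    rw [hr]
    ring
  rcases mul_eq_zero.1 key with h | h
  · exact pow_eq_zero_iff (by omega) |>.1 h
  · exact absurd h (pow_ne_zero _ hga)

lemma powersum_bound (S : Multiset ℂ) (R C : ℝ) (hR : 0 < R)
    (h : ∀ t : ℕ, 1 ≤ t → ‖(S.map (fun β => β ^ t)).sum‖ ≤ C * R ^ t) :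
    ∀ β ∈ S, ‖β‖ ≤ R := by
  classical
  intro γ hγ
  set T := S.toFinset with hT
  have hγT : γ ∈ T := by simpa [hT] using hγ
  let A : ℂ[X] := ∏ δ ∈ T.erase γ, (X - Polynomial.C δ)
  have hA0 : A.eval γ ≠ 0 := by
    simp only [A, eval_prod, Finset.prod_ne_zero_iff]
    intro δ hδ
    simp only [eval_sub, eval_X, eval_C]
    exact sub_ne_zero.2 (Finset.ne_of_mem_erase hδ).symm
  have hAδ : ∀ δ ∈ T, δ ≠ γ → A.eval δ = 0 := by
    intro δ hδ hne
    simp only [A, eval_prod]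
    exact Finset.prod_eq_zero (Finset.mem_erase.2 ⟨hne, hδ⟩) (by simp)
  have hps : ∀ t, (S.map (fun β => β ^ t)).sum = ∑ δ ∈ T, (S.count δ : ℂ) * δ ^ t := by
    intro t
    rw [Finset.sum_multiset_map_count]
    simp [hT]
  have key : ∀ t : ℕ, ∑ i ∈ Finset.range (A.natDegree + 1), A.coeff i * (S.map (fun β => β ^ (t + i))).sum
      = (S.count γ : ℂ) * γ ^ t * A.eval γ := by
    intro t
    simp_rw [hps, Finset.mul_sum]
    rw [Finset.sum_comm, Finset.sum_eq_single γ]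
    · rw [eval_eq_sum_range, Finset.mul_sum]
      refine Finset.sum_congr rfl fun i _ => ?_
      ring
    · intro δ hδ hne
      have := hAδ δ hδ hne
      rw [eval_eq_sum_range] at this
      calc _ = (S.count δ : ℂ) * δ ^ t * ∑ i ∈ Finset.range (A.natDegree + 1), A.coeff i * δ ^ i := by
            rw [Finset.mul_sum]
            refine Finset.sum_congr rfl fun i _ => ?_
            ring
        _ = 0 := by rw [this, mul_zero]
    · intro h; exact absurd hγT h
  have hcnt : (S.count γ : ℂ) ≠ 0 := by
    exact_mod_cast (Multiset.count_pos.2 hγ).ne'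
  set C1 := ∑ i ∈ Finset.range (A.natDegree + 1), ‖A.coeff i‖ * (C * R ^ i) with hC1
  set n0 := ‖(S.count γ : ℂ)‖ * ‖A.eval γ‖ with hn0
  have hn0pos : 0 < n0 := mul_pos (norm_pos_iff.2 hcnt) (norm_pos_iff.2 hA0)
  have hb : ∀ t : ℕ, 1 ≤ t → (‖γ‖ / R) ^ t ≤ C1 / n0 := by
    intro t ht
    have h1 : n0 * ‖γ‖ ^ t ≤ C1 * R ^ t := by
      calc n0 * ‖γ‖ ^ t = ‖(S.count γ : ℂ) * γ ^ t * A.eval γ‖ := by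
            rw [norm_mul, norm_mul, norm_pow, hn0]; ring
        _ ≤ _ := by
            rw [← key t, hC1, Finset.sum_mul]
            refine (norm_sum_le _ _).trans (Finset.sum_le_sum fun i _ => ?_)
            rw [norm_mul]
            have := mul_le_mul_of_nonneg_left (h (t + i) (by omega)) (norm_nonneg (A.coeff i))
            calc _ ≤ _ := this
              _ = _ := by rw [pow_add]; ring
    rw [div_pow, div_le_div_iff₀ (by positivity) hn0pos]
    linarith
  by_contra hlt
  push Not at hlt
  have h1 : 1 < ‖γ‖ / R := (one_lt_div hR).2 hlt
  obtain ⟨t, ht⟩ := pow_unbounded_of_one_lt (C1 / n0) h1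
  have h2 := hb (t + 1) (by omega)
  have h3 : (‖γ‖ / R) ^ t ≤ (‖γ‖ / R) ^ (t + 1) := pow_le_pow_right₀ h1.le (by omega)
  linarith

open PowerSeries in
lemma logderiv_multiset (S : Multiset ℂ) :
    (PowerSeries.X : PowerSeries ℂ) * PowerSeries.derivative ℂ
        ((S.map (fun α => (1 - PowerSeries.C α * PowerSeries.X : PowerSeries ℂ))).prod)
      = (S.map (fun α => (1 - PowerSeries.C α * PowerSeries.X : PowerSeries ℂ))).prod *
        PowerSeries.mk (fun r => if r = 0 then 0 else -(S.map (fun α => α ^ r)).sum) := by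
  induction S using Multiset.induction with
  | empty =>
    simp
    ext r
    simp
  | cons α S ih =>
    have h1 : (1 - PowerSeries.C α * PowerSeries.X : PowerSeries ℂ) *
        PowerSeries.mk (fun r => if r = 0 then 0 else -α ^ r) = - (PowerSeries.C α * PowerSeries.X) := by
      ext r
      rcases r with _ | r
      · simp
      · rw [sub_mul, one_mul, map_sub, mul_assoc, PowerSeries.coeff_C_mul, PowerSeries.coeff_succ_X_mul]
        rw [map_neg, PowerSeries.coeff_C_mul, PowerSeries.coeff_mk, PowerSeries.coeff_mk, PowerSeries.coeff_X]
        rcases r with _ | r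
        · simp
        · simp; ring
    have h2 : PowerSeries.mk (fun r => if r = 0 then (0:ℂ) else -((α ::ₘ S).map (fun α => α ^ r)).sum)
        = PowerSeries.mk (fun r => if r = 0 then 0 else -α ^ r) +
          PowerSeries.mk (fun r => if r = 0 then 0 else -(S.map (fun α => α ^ r)).sum) := by
      ext r
      rcases r with _ | r
      · simp
      · simp; ring
    rw [h2, Multiset.map_cons, Multiset.prod_cons]
    set P := (S.map (fun α => (1 - PowerSeries.C α * PowerSeries.X : PowerSeries ℂ))).prod
    have h3 : PowerSeries.derivative ℂ (1 - PowerSeries.C α * PowerSeries.X : PowerSeries ℂ) = - PowerSeries.C α := by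
      ext r
      rw [PowerSeries.coeff_derivative]
      rcases r with _ | r
      · simp
      · simp [PowerSeries.coeff_C, PowerSeries.coeff_X, PowerSeries.coeff_one]
    rw [Derivation.leibniz, h3, smul_eq_mul, smul_eq_mul]
    linear_combination (1 - PowerSeries.C α * PowerSeries.X : PowerSeries ℂ) * ih - P * h1

lemma newton_roots (c Λ : ℕ → ℂ) (m : ℕ) (hc0 : c 0 = 1) (hcm : ∀ k, m < k → c k = 0)
    (hN : ∀ k : ℕ, (k : ℂ) * c k = ∑ r ∈ Finset.Icc 1 k, Λ r * c (k - r)) :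
    ∃ S : Multiset ℂ, S.card ≤ m ∧ ∀ r, 1 ≤ r → Λ r = -(S.map (fun α => α ^ r)).sum := by
  let L : ℂ[X] := ∑ k ∈ Finset.range (m + 1), Polynomial.monomial k (c k)
  have hL : ∀ k, L.coeff k = c k := by
    intro k
    simp only [L, Polynomial.finsetSum_coeff, Polynomial.coeff_monomial]
    rw [Finset.sum_ite_eq' (Finset.range (m+1)) k]
    split_ifs with h
    · rfl
    · exact (hcm k (by simpa using h)).symm
  have hLdeg : L.natDegree ≤ m := by
    rw [Polynomial.natDegree_le_iff_coeff_eq_zero]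
    intro k hk; rw [hL]; exact hcm k hk
  have hL0 : L ≠ 0 := by
    intro h; have := hL 0; rw [h, hc0] at this; simp at this
  have hprod := (IsAlgClosed.splits L).eq_prod_roots
  have hne : ∀ ρ ∈ L.roots, ρ ≠ 0 := by
    rintro ρ hρ rfl
    rw [mem_roots hL0, IsRoot.def, ← coeff_zero_eq_eval_zero, hL, hc0] at hρ
    exact one_ne_zero hρ
  have hfac : ∃ a : ℂ, L = Polynomial.C a * ((L.roots.map (fun x => x⁻¹)).map (fun α => 1 - Polynomial.C α * Polynomial.X)).prod := by
    have : ∀ T : Multiset ℂ, (∀ ρ ∈ T, ρ ≠ 0) → ∃ a : ℂ, (T.map (fun ρ => Polynomial.X - Polynomial.C ρ)).prod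
        = Polynomial.C a * ((T.map (fun x => x⁻¹)).map (fun α => 1 - Polynomial.C α * Polynomial.X)).prod := by
      intro T
      induction T using Multiset.induction with
      | empty => intro _; exact ⟨1, by simp⟩
      | cons ρ T ih =>
        intro hT
        obtain ⟨a, ha⟩ := ih (fun x hx => hT x (Multiset.mem_cons_of_mem hx))
        have hρ := hT ρ (Multiset.mem_cons_self _ _)
        refine ⟨-ρ * a, ?_⟩
        simp only [Multiset.map_cons, Multiset.prod_cons]
        rw [ha]
        have h1 : (Polynomial.C ρ : ℂ[X]) * Polynomial.C ρ⁻¹ = 1 := by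
          rw [← Polynomial.C_mul, mul_inv_cancel₀ hρ, Polynomial.C_1]
        simp only [Polynomial.C_mul, Polynomial.C_neg]
        generalize (Multiset.map (fun α => 1 - Polynomial.C α * Polynomial.X) (Multiset.map (fun x => x⁻¹) T)).prod = P
        linear_combination (-Polynomial.C a * P * Polynomial.X) * h1
    obtain ⟨a, ha⟩ := this L.roots hne
    refine ⟨L.leadingCoeff * a, ?_⟩
    rw [Polynomial.C_mul, mul_assoc, ← ha]
    exact hprod
  obtain ⟨a, ha⟩ := hfac
  set S := L.roots.map (fun x => x⁻¹) with hS
  have ha1 : a = 1 := by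
    have h0 := congrArg (Polynomial.eval 0) ha
    rw [← coeff_zero_eq_eval_zero, hL, hc0, Polynomial.eval_mul, Polynomial.eval_C, Polynomial.eval_multiset_prod,
      Multiset.map_map] at h0
    simp at h0
    exact h0.symm
  rw [ha1, Polynomial.C_1, one_mul] at ha
  have hLP : (L : PowerSeries ℂ) = (S.map (fun α => (1 - PowerSeries.C α * PowerSeries.X : PowerSeries ℂ))).prod := by
    have h := congrArg (Polynomial.coeToPowerSeries.ringHom (R := ℂ)) ha
    rw [map_multiset_prod, Multiset.map_map] at h
    have h2 : (coeToPowerSeries.ringHom ∘ fun α : ℂ => (1 - Polynomial.C α * Polynomial.X : ℂ[X]))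
        = fun α => (1 - PowerSeries.C α * PowerSeries.X : PowerSeries ℂ) := by
      funext α
      simp
    rw [h2] at h
    simpa using h
  refine ⟨S, ?_, ?_⟩
  · rw [hS, Multiset.card_map]; exact (card_roots' L).trans hLdeg
  · have hlog := logderiv_multiset S
    rw [← hLP] at hlog
    have hlog2 : (PowerSeries.X : PowerSeries ℂ) * PowerSeries.derivative ℂ (L : PowerSeries ℂ)
        = L * PowerSeries.mk (fun r => if r = 0 then 0 else Λ r) := by
      ext k
      have e1 : PowerSeries.coeff k ((PowerSeries.X : PowerSeries ℂ) * PowerSeries.derivative ℂ (L : PowerSeries ℂ))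
          = k * c k := by
        rcases k with _ | k
        · simp
        · rw [PowerSeries.coeff_succ_X_mul, PowerSeries.coeff_derivative, Polynomial.coeff_coe, hL]
          push_cast; ring
      rw [e1, hN, mul_comm (L : PowerSeries ℂ), PowerSeries.coeff_mul, Finset.Nat.sum_antidiagonal_eq_sum_range_succ_mk,
        Finset.range_eq_Ico, Finset.sum_eq_sum_Ico_succ_bot (by omega)]
      simp only [PowerSeries.coeff_mk, Polynomial.coeff_coe, hL]
      simp only [if_true, zero_mul, zero_add]
      refine Finset.sum_congr (by ext; simp) fun r hr => ?_
      rw [if_neg (by simp at hr; omega)]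
    have hLne : (L : PowerSeries ℂ) ≠ 0 := by simpa using hL0
    have := mul_left_cancel₀ hLne (hlog2.symm.trans hlog)
    intro r hr
    have := congrArg (PowerSeries.coeff r) this
    simpa [show r ≠ 0 by omega] using this

/-- Monic polynomials of degree `k`. -/
noncomputable def monicsDeg (K : Type*) [Field K] [Finite K] (k : ℕ) : Finset K[X] := by
  classical
  exact (Set.Finite.subset (s := ((degreeLT K (k + 1) : Submodule K K[X]) : Set K[X]))
    (by
      have : Finite (degreeLT K (k + 1)) := Finite.of_equiv _ (degreeLTEquiv K (k+1)).toEquiv.symm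
      exact Set.toFinite _)
    (t := {f : K[X] | f.Monic ∧ f.natDegree = k})
    (by
      rintro f ⟨hf, hk⟩
      rw [SetLike.mem_coe, mem_degreeLT]
      refine lt_of_le_of_lt degree_le_natDegree ?_
      rw [hk]; norm_cast; omega)).toFinset

lemma mem_monicsDeg {K : Type*} [Field K] [Finite K] {k : ℕ} {f : K[X]} :
    f ∈ monicsDeg K k ↔ f.Monic ∧ f.natDegree = k := by
  simp [monicsDeg]

open Classical in
/-- Monic irreducible polynomials of degree at most `N`. -/
noncomputable def irrDeg (K : Type*) [Field K] [Finite K] (N : ℕ) : Finset K[X] :=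
  (Finset.range (N + 1)).biUnion fun k => (monicsDeg K k).filter Irreducible

lemma mem_irrDeg {K : Type*} [Field K] [Finite K] {N : ℕ} {f : K[X]} :
    f ∈ irrDeg K N ↔ f.Monic ∧ Irreducible f ∧ f.natDegree ≤ N := by
  simp only [irrDeg, Finset.mem_biUnion, Finset.mem_range, Finset.mem_filter, mem_monicsDeg]
  constructor
  · rintro ⟨k, hk, ⟨h1, h2⟩, h3⟩
    exact ⟨h1, h3, by omega⟩
  · rintro ⟨h1, h2, h3⟩
    exact ⟨_, by omega, ⟨h1, rfl⟩, h2⟩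

/-- Coefficients of the L-function. -/
noncomputable def cSum {K : Type*} [Field K] [Finite K] (φ : K[X] →* ℂ) (k : ℕ) : ℂ :=
  ∑ f ∈ monicsDeg K k, φ f

/-- Coefficients of its logarithmic derivative. -/
noncomputable def lamSum {K : Type*} [Field K] [Finite K] (φ : K[X] →* ℂ) (r : ℕ) : ℂ :=
  ∑ P ∈ irrDeg K r, if P.natDegree ∣ r then (P.natDegree : ℂ) * φ P ^ (r / P.natDegree) else 0

open Classical in
lemma degree_identity {K : Type*} [Field K] [Finite K] {k : ℕ} {f : K[X]} (hf : f.Monic)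
    (hk : f.natDegree = k) :
    ∑ P ∈ irrDeg K k, ∑ r ∈ Finset.Icc 1 k,
      (if P.natDegree ∣ r ∧ P ^ (r / P.natDegree) ∣ f then P.natDegree else 0) = k := by
  have hf0 := hf.ne_zero
  have hin : ∀ P ∈ irrDeg K k, ∑ r ∈ Finset.Icc 1 k,
      (if P.natDegree ∣ r ∧ P ^ (r / P.natDegree) ∣ f then P.natDegree else 0)
      = (UniqueFactorizationMonoid.normalizedFactors f).count P * P.natDegree := by
    intro P hP
    obtain ⟨hP1, hP2, hP3⟩ := mem_irrDeg.1 hP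
    have hPd : 0 < P.natDegree := hP2.natDegree_pos
    rw [← Finset.sum_filter, Finset.sum_const, smul_eq_mul]
    congr 1
    have hdvd : ∀ j, P ^ j ∣ f ↔ j ≤ (UniqueFactorizationMonoid.normalizedFactors f).count P := by
      intro j
      have := UniqueFactorizationMonoid.le_emultiplicity_iff_replicate_le_normalizedFactors hP2 hf0 (n := j)
      rw [pow_dvd_iff_le_emultiplicity, this, Multiset.le_count_iff_replicate_le, hP1.normalize_eq_self]
    have : (Finset.Icc 1 k).filter (fun r => P.natDegree ∣ r ∧ P ^ (r / P.natDegree) ∣ f)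
        = (Finset.Icc 1 ((UniqueFactorizationMonoid.normalizedFactors f).count P)).image (fun j => P.natDegree * j) := by
      ext r
      simp only [Finset.mem_filter, Finset.mem_Icc, Finset.mem_image]
      constructor
      · rintro ⟨⟨h1, h2⟩, ⟨j, rfl⟩, h4⟩
        rw [Nat.mul_div_cancel_left _ hPd] at h4
        exact ⟨j, ⟨by rcases j with _ | j <;> simp_all, (hdvd j).1 h4⟩, rfl⟩
      · rintro ⟨j, ⟨h1, h2⟩, rfl⟩
        have h3 := (hdvd j).2 h2
        refine ⟨⟨Nat.mul_pos hPd h1, ?_⟩, dvd_mul_right _ _, ?_⟩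
        · have := natDegree_le_of_dvd h3 hf0
          rw [hP1.natDegree_pow, hk] at this
          rw [mul_comm]; exact this
        · rw [Nat.mul_div_cancel_left _ hPd]; exact h3
    rw [this, Finset.card_image_of_injective _ (fun a b h => Nat.eq_of_mul_eq_mul_left hPd h)]
    simp
  rw [Finset.sum_congr rfl hin]
  have hprod : (UniqueFactorizationMonoid.normalizedFactors f).prod = f := by
    rw [UniqueFactorizationMonoid.prod_normalizedFactors_eq hf0, hf.normalize_eq_self]
  have hmon : ∀ P ∈ UniqueFactorizationMonoid.normalizedFactors f, P.Monic ∧ Irreducible P := by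
    intro P hP
    have hirr := UniqueFactorizationMonoid.irreducible_of_normalized_factor P hP
    refine ⟨?_, hirr⟩
    rw [← UniqueFactorizationMonoid.normalize_normalized_factor P hP]
    exact monic_normalize hirr.ne_zero
  have hdeg : ((UniqueFactorizationMonoid.normalizedFactors f).map natDegree).sum = k := by
    rw [← hk]
    conv_rhs => rw [← hprod]
    rw [natDegree_multiset_prod_of_monic _ (fun P hP => (hmon P hP).1)]
  rw [Finset.sum_multiset_map_count] at hdeg
  simp only [smul_eq_mul] at hdeg
  conv_rhs => rw [← hdeg]
  symm
  refine Finset.sum_subset ?_ ?_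
  · intro P hP
    rw [Multiset.mem_toFinset] at hP
    refine mem_irrDeg.2 ⟨(hmon P hP).1, (hmon P hP).2, ?_⟩
    rw [← hk]
    exact natDegree_le_of_dvd (UniqueFactorizationMonoid.dvd_of_mem_normalizedFactors hP) hf0
  · intro P _ hP
    rw [Multiset.mem_toFinset, ← Multiset.count_eq_zero] at hP
    rw [hP, zero_mul]

lemma newton_identity {K : Type*} [Field K] [Finite K] (φ : K[X] →* ℂ) (k : ℕ) :
    (k : ℂ) * cSum φ k = ∑ r ∈ Finset.Icc 1 k, lamSum φ r * cSum φ (k - r) := by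
  classical
  have hlam : ∀ r ∈ Finset.Icc 1 k, lamSum φ r =
      ∑ P ∈ irrDeg K k, if P.natDegree ∣ r then (P.natDegree : ℂ) * φ P ^ (r / P.natDegree) else 0 := by
    intro r hr
    rw [Finset.mem_Icc] at hr
    refine Finset.sum_subset ?_ ?_
    · intro P hP
      rw [mem_irrDeg] at hP ⊢
      exact ⟨hP.1, hP.2.1, hP.2.2.trans hr.2⟩
    · intro P hP hP'
      rw [if_neg]
      intro hd
      rw [mem_irrDeg] at hP hP'
      exact hP' ⟨hP.1, hP.2.1, Nat.le_of_dvd hr.1 hd⟩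
  have hshift : ∀ r ∈ Finset.Icc 1 k, ∀ P ∈ irrDeg K k, P.natDegree ∣ r →
      φ P ^ (r / P.natDegree) * cSum φ (k - r)
        = ∑ f ∈ monicsDeg K k, if P ^ (r / P.natDegree) ∣ f then φ f else 0 := by
    intro r hr P hP hd
    rw [Finset.mem_Icc] at hr
    obtain ⟨hP1, hP2, hP3⟩ := mem_irrDeg.1 hP
    have hQ : (P ^ (r / P.natDegree)).Monic := hP1.pow _
    have hQd : (P ^ (r / P.natDegree)).natDegree = r := by
      rw [hP1.natDegree_pow, Nat.div_mul_cancel hd]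
    rw [← map_pow]
    generalize P ^ (r / P.natDegree) = Q at *
    rw [← Finset.sum_filter, cSum, Finset.mul_sum]
    refine Finset.sum_bij (fun h _ => Q * h) ?_ ?_ ?_ ?_
    · intro h hh
      rw [mem_monicsDeg] at hh
      rw [Finset.mem_filter, mem_monicsDeg]
      refine ⟨⟨hQ.mul hh.1, ?_⟩, dvd_mul_right _ _⟩
      rw [hQ.natDegree_mul hh.1]; omega
    · intro a _ b _ hab
      exact mul_left_cancel₀ hQ.ne_zero hab
    · intro f hf
      rw [Finset.mem_filter, mem_monicsDeg] at hf
      obtain ⟨⟨h1, h2⟩, h, rfl⟩ := hf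
      have h3 : h.Monic := hQ.of_mul_monic_left h1
      refine ⟨h, ?_, rfl⟩
      rw [mem_monicsDeg]
      rw [hQ.natDegree_mul h3] at h2
      exact ⟨h3, by omega⟩
    · intro h _
      rw [map_mul]
  calc (k : ℂ) * cSum φ k = ∑ f ∈ monicsDeg K k, (k : ℂ) * φ f := by rw [cSum, Finset.mul_sum]
    _ = ∑ f ∈ monicsDeg K k, ∑ P ∈ irrDeg K k, ∑ r ∈ Finset.Icc 1 k,
          (if P.natDegree ∣ r ∧ P ^ (r / P.natDegree) ∣ f then (P.natDegree : ℂ) * φ f else 0) := by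
        refine Finset.sum_congr rfl fun f hf => ?_
        rw [mem_monicsDeg] at hf
        have := degree_identity hf.1 hf.2
        conv_lhs => rw [← this]
        push_cast
        rw [Finset.sum_mul]
        refine Finset.sum_congr rfl fun P _ => ?_
        rw [Finset.sum_mul]
        refine Finset.sum_congr rfl fun r _ => ?_
        split_ifs <;> simp
    _ = ∑ r ∈ Finset.Icc 1 k, ∑ P ∈ irrDeg K k, ∑ f ∈ monicsDeg K k,
          (if P.natDegree ∣ r ∧ P ^ (r / P.natDegree) ∣ f then (P.natDegree : ℂ) * φ f else 0) := by
        rw [Finset.sum_comm]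
        rw [Finset.sum_congr rfl (fun P _ => Finset.sum_comm)]
        rw [Finset.sum_comm]
    _ = _ := by
        refine Finset.sum_congr rfl fun r hr => ?_
        rw [hlam r hr, Finset.sum_mul]
        refine Finset.sum_congr rfl fun P hP => ?_
        by_cases hd : P.natDegree ∣ r
        · simp only [hd, true_and, if_true]
          rw [mul_assoc, hshift r hr P hP hd, Finset.mul_sum]
          refine Finset.sum_congr rfl fun f _ => ?_
          split_ifs <;> simp
        · simp [hd]

lemma lamSum_eq {K : Type*} [Field K] [Finite K] (φ : K[X] →* ℂ) {k : Type*} [Field k] [Fintype k]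
    [Algebra K k] (r : ℕ) (hr : Module.finrank K k = r) :
    lamSum φ r = ∑ a : k, φ (minpoly K a) ^ (r / (minpoly K a).natDegree) := by
  classical
  have := Fintype.ofFinite K
  have hintg : ∀ a : k, IsIntegral K a := fun a => Algebra.IsIntegral.isIntegral a
  have hdr : ∀ a : k, (minpoly K a).natDegree ∣ r := by
    intro a
    rw [← IntermediateField.adjoin.finrank (hintg a), ← hr]
    exact ⟨_, (Module.finrank_mul_finrank K (IntermediateField.adjoin K {a}) k).symm⟩
  have hrpos : 0 < r := by rw [← hr]; exact Module.finrank_pos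
  rw [← Finset.sum_fiberwise_of_maps_to (s := Finset.univ) (t := irrDeg K r) (g := fun a : k => minpoly K a)]
  · rw [lamSum]
    refine Finset.sum_congr rfl fun P hP => ?_
    obtain ⟨hP1, hP2, hP3⟩ := mem_irrDeg.1 hP
    rw [Finset.sum_congr rfl (g := fun _ => φ P ^ (r / P.natDegree))
      (fun a ha => by rw [Finset.mem_filter] at ha; rw [ha.2])]
    rw [Finset.sum_const, nsmul_eq_mul]
    split_ifs with hd
    · congr 2
      have hroot : ∃ a : k, minpoly K a = P := by
        have hf := Fact.mk hP2
        have : Module.finrank K (AdjoinRoot P) = P.natDegree := (AdjoinRoot.powerBasis hP2.ne_zero).finrank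
        have hfd : FiniteDimensional K (AdjoinRoot P) := (AdjoinRoot.powerBasis hP2.ne_zero).finite
        have hfin : Finite (AdjoinRoot P) := Module.finite_of_finite K
        obtain ⟨ψ⟩ := FiniteField.nonempty_algHom_of_finrank_dvd (F := K) (K := AdjoinRoot P) (L := k)
          (by rw [this, hr]; exact hd)
        refine ⟨ψ (AdjoinRoot.root P), ?_⟩
        rw [minpoly.algHom_eq _ ψ.injective, AdjoinRoot.minpoly_root hP2.ne_zero]
        simp [hP1.leadingCoeff]
      obtain ⟨a, rfl⟩ := hroot
      have h1 := card_rootSet_eq_natDegree (K := k) (p := minpoly K a) (Algebra.IsSeparable.isSeparable K a)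
        (Normal.splits inferInstance a)
      rw [← h1, Fintype.card_subtype]
      congr 1
      ext b
      simp only [Finset.mem_filter, Finset.mem_univ, true_and]
      rw [mem_rootSet_of_ne (minpoly.ne_zero (hintg a))]
      constructor
      · intro h
        exact (minpoly.eq_of_irreducible_of_monic hP2 h hP1).symm
      · intro h; rw [← h]; exact minpoly.aeval K b
    · rw [Finset.card_eq_zero.2, Nat.cast_zero, zero_mul]
      rw [Finset.filter_eq_empty_iff]
      intro a _ h
      exact hd (h ▸ hdr a)
  · intro a _
    exact mem_irrDeg.2 ⟨minpoly.monic (hintg a), minpoly.irreducible (hintg a), Nat.le_of_dvd hrpos (hdr a)⟩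

open IntermediateField in
lemma frob_pow_ne {K k : Type*} [Field K] [Fintype K] [Field k] [Finite k] [Algebra K k] (a : k) (i : ℕ)
    (hi : 0 < i) (hi2 : i < (minpoly K a).natDegree) : a ^ (Fintype.card K) ^ i ≠ a := by
  classical
  have := Fintype.ofFinite k
  intro h
  have hintg : IsIntegral K a := Algebra.IsIntegral.isIntegral a
  let f : k →ₐ[K] k := (FiniteField.frobeniusAlgHom K k) ^ i
  have hf : ∀ x, f x = x ^ (Fintype.card K) ^ i := by
    intro x
    simp only [f, AlgHom.coe_pow, FiniteField.coe_frobeniusAlgHom]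
    rw [pow_iterate]
  have hle : Algebra.adjoin K {a} ≤ AlgHom.equalizer f (AlgHom.id K k) := by
    rw [Algebra.adjoin_le_iff, Set.singleton_subset_iff]
    change f a = a
    rw [hf, h]
  have hall : ∀ x ∈ K⟮a⟯, x ^ (Fintype.card K) ^ i = x := by
    intro x hx
    have hx' : x ∈ Algebra.adjoin K {a} := by
      rw [← adjoin_simple_toSubalgebra_of_isAlgebraic hintg.isAlgebraic]; exact hx
    have := hle hx'
    rw [← hf]; exact this
  have hq : 1 < Fintype.card K := Fintype.one_lt_card
  have hqi : 1 < Fintype.card K ^ i := Nat.one_lt_pow hi.ne' hq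
  have hcard : Nat.card K⟮a⟯ = Fintype.card K ^ (minpoly K a).natDegree := by
    rw [Module.natCard_eq_pow_finrank (K := K), adjoin.finrank hintg, Nat.card_eq_fintype_card]
  have hsub : (Finset.univ.filter (fun x => x ∈ K⟮a⟯)) ⊆ (X ^ (Fintype.card K ^ i) - X : k[X]).roots.toFinset := by
    intro x hx
    rw [Finset.mem_filter] at hx
    rw [Multiset.mem_toFinset, mem_roots (FiniteField.X_pow_card_sub_X_ne_zero k hqi)]
    simp [hall x hx.2]
  have h1 := (Finset.card_le_card hsub).trans ((Multiset.toFinset_card_le _).trans (card_roots' _))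
  rw [FiniteField.X_pow_card_sub_X_natDegree_eq k hqi] at h1
  have h2 : (Finset.univ.filter (fun x => x ∈ K⟮a⟯)).card = Nat.card K⟮a⟯ := by
    rw [← Fintype.card_subtype, Nat.card_eq_fintype_card]
  rw [h2, hcard] at h1
  exact absurd h1 (not_le.2 (Nat.pow_lt_pow_right hq hi2))

lemma prod_range_periodic {M : Type*} [CommMonoid M] (f : ℕ → M) (δ t : ℕ) (hf : ∀ j, f (δ + j) = f j) :
    ∏ j ∈ Finset.range (δ * t), f j = (∏ j ∈ Finset.range δ, f j) ^ t := by
  induction t with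
  | zero => simp
  | succ t ih =>
    rw [Nat.mul_succ, add_comm, Finset.prod_range_add, pow_succ, mul_comm, ← ih]
    congr 1
    exact Finset.prod_congr rfl fun j _ => hf j

open IntermediateField in
lemma minpoly_eval_prod {K k : Type*} [Field K] [Fintype K] [Field k] [Finite k] [Algebra K k] (a w : k) (r : ℕ)
    (hr : Module.finrank K k = r) :
    (aeval w (minpoly K a)) ^ (r / (minpoly K a).natDegree)
      = ∏ j ∈ Finset.range r, (w - a ^ (Fintype.card K) ^ j) := by
  classical
  have := Fintype.ofFinite k
  have hintg : IsIntegral K a := Algebra.IsIntegral.isIntegral a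
  set δ := (minpoly K a).natDegree with hδ
  set q := Fintype.card K with hqdef
  have hδpos : 0 < δ := minpoly.natDegree_pos hintg
  obtain ⟨t, ht⟩ : δ ∣ r := by
    rw [hδ, ← adjoin.finrank hintg, ← hr]
    exact ⟨_, (Module.finrank_mul_finrank K K⟮a⟯ k).symm⟩
  have hper : a ^ q ^ δ = a := by
    have hc : Nat.card K⟮a⟯ = q ^ δ := by
      rw [Module.natCard_eq_pow_finrank (K := K), adjoin.finrank hintg, Nat.card_eq_fintype_card]
    have := FiniteField.pow_card (AdjoinSimple.gen K a)
    rw [← Nat.card_eq_fintype_card, hc] at this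
    have := congrArg (algebraMap K⟮a⟯ k) this
    simpa using this
  have hfinj : ∀ i, Function.Injective (fun x : k => x ^ q ^ i) := by
    intro i
    have h := ((FiniteField.frobeniusAlgHom K k) ^ i).toRingHom.injective
    convert h using 1
    funext x
    simp [FiniteField.coe_frobeniusAlgHom, pow_iterate, hqdef]
  have hinj : Set.InjOn (fun j => a ^ q ^ j) (Finset.range δ : Set ℕ) := by
    have aux : ∀ i j, i < j → j < δ → a ^ q ^ i ≠ a ^ q ^ j := by
      intro i j hij hj h
      refine frob_pow_ne (K := K) a (j - i) (by omega) (by omega) ?_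
      refine hfinj i ?_
      simp only
      rw [← pow_mul, ← pow_add, h]
      congr 2; omega
    intro i hi j hj h
    simp only [Finset.coe_range, Set.mem_Iio] at hi hj
    rcases lt_trichotomy i j with hlt | heq | hgt
    · exact absurd h (aux i j hlt hj)
    · exact heq
    · exact absurd h.symm (aux j i hgt hi)
  have hsplit : ((minpoly K a).map (algebraMap K k)).Splits := Normal.splits inferInstance a
  have hsep : (minpoly K a).Separable := Algebra.IsSeparable.isSeparable K a
  have hnodup : ((minpoly K a).map (algebraMap K k)).roots.Nodup := nodup_roots hsep.map
  have hmonic : ((minpoly K a).map (algebraMap K k)).Monic := (minpoly.monic hintg).map _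
  have hcardr : ((minpoly K a).map (algebraMap K k)).roots.card = δ := by
    rw [← hsplit.natDegree_eq_card_roots, natDegree_map]
  have himg : (Finset.range δ).image (fun j => a ^ q ^ j) = ((minpoly K a).map (algebraMap K k)).roots.toFinset := by
    refine Finset.eq_of_subset_of_card_le ?_ ?_
    · intro x hx
      rw [Finset.mem_image] at hx
      obtain ⟨j, _, rfl⟩ := hx
      rw [Multiset.mem_toFinset, mem_roots hmonic.ne_zero, IsRoot.def, eval_map_algebraMap]
      have h1 : a ^ q ^ j = ((FiniteField.frobeniusAlgHom K k) ^ j) a := by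
        simp [FiniteField.coe_frobeniusAlgHom, pow_iterate, hqdef]
      rw [h1, aeval_algHom_apply, minpoly.aeval, map_zero]
    · rw [Finset.card_image_of_injOn hinj, Finset.card_range]
      exact (Multiset.toFinset_card_le _).trans hcardr.le
  have hev : aeval w (minpoly K a) = ∏ j ∈ Finset.range δ, (w - a ^ q ^ j) := by
    rw [← eval_map_algebraMap]
    conv_lhs => rw [hsplit.eq_prod_roots_of_monic hmonic]
    rw [eval_multiset_prod, Multiset.map_map]
    rw [← Finset.prod_image (s := Finset.range δ) (g := fun j => a ^ q ^ j) (f := fun x => w - x) hinj, himg,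
      Finset.prod_eq_multiset_prod, Multiset.toFinset_val, hnodup.dedup]
    simp
  rw [hev, ht, Nat.mul_div_cancel_left _ hδpos, prod_range_periodic]
  intro j
  rw [pow_add, pow_mul, hper]

/-- evaluation of a character at `v`, as a monoid hom. -/
noncomputable def evChar {K E : Type*} [Field K] [Field E] [Algebra K E] (χ : MulChar E ℂ) (v : E) : K[X] →* ℂ :=
  χ.toMonoidHom.comp ((aeval v : K[X] →ₐ[K] E) : K[X] →* E)

lemma evChar_apply {K E : Type*} [Field K] [Field E] [Algebra K E] (χ : MulChar E ℂ) (v : E) (f : K[X]) :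
    evChar χ v f = χ (aeval v f) := rfl

open IntermediateField in
lemma csum_zero {K E : Type*} [Field K] [Fintype K] [Field E] [Fintype E] [Algebra K E] (χ : MulChar E ℂ)
    (hχ : χ ≠ 1) (v : E) (hv : K⟮v⟯ = ⊤) (k : ℕ) (hk : Module.finrank K E ≤ k) :
    cSum (K := K) (evChar χ v) k = 0 := by
  classical
  have hintg : IsIntegral K v := Algebra.IsIntegral.isIntegral v
  have hm : (minpoly K v).natDegree = Module.finrank K E := by
    rw [← adjoin.finrank hintg, hv, finrank_top']
  have hex : ∀ e : E, ∃ h : K[X], h.degree < k ∧ aeval v h = e := by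
    intro e
    have he : e ∈ Algebra.adjoin K {v} := by
      rw [← adjoin_simple_toSubalgebra_of_isAlgebraic hintg.isAlgebraic, hv]; trivial
    rw [Algebra.adjoin_singleton_eq_range_aeval] at he
    obtain ⟨f, hf⟩ := he
    refine ⟨f %ₘ minpoly K v, ?_, ?_⟩
    · refine (degree_modByMonic_lt _ (minpoly.monic hintg)).trans_le ?_
      refine degree_le_natDegree.trans ?_
      rw [hm]; exact_mod_cast hk
    · rw [aeval_modByMonic_eq_self_of_root (minpoly.aeval K v)]; exact hf
  have hshift : ∀ e : E, cSum (K := K) (evChar χ v) k = ∑ f ∈ monicsDeg K k, χ (aeval v f + e) := by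
    intro e
    obtain ⟨h, hdeg, he⟩ := hex e
    have aux : ∀ f : K[X], f ∈ monicsDeg K k → ∀ h : K[X], h.degree < k → f + h ∈ monicsDeg K k := by
      intro f hf h hh
      rw [mem_monicsDeg] at hf ⊢
      have h1 : h.degree < f.degree := by
        rw [degree_eq_natDegree hf.1.ne_zero, hf.2]; exact hh
      exact ⟨hf.1.add_of_left h1, by rw [natDegree_add_eq_left_of_degree_lt h1, hf.2]⟩
    symm
    refine Finset.sum_bij (fun f _ => f + h) (fun f hf => aux f hf h hdeg) ?_ ?_ ?_
    · intro a _ b _ hab; exact add_right_cancel hab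
    · intro f hf
      exact ⟨f - h, by rw [sub_eq_add_neg]; exact aux f hf (-h) (by rwa [degree_neg]), by simp⟩
    · intro f _
      rw [evChar_apply, map_add (aeval v), he]
  have h1 : (Fintype.card E : ℂ) * cSum (K := K) (evChar χ v) k = 0 := by
    calc (Fintype.card E : ℂ) * cSum (K := K) (evChar χ v) k = ∑ e : E, cSum (K := K) (evChar χ v) k := by
          rw [Finset.sum_const, Finset.card_univ, nsmul_eq_mul]
      _ = ∑ e : E, ∑ f ∈ monicsDeg K k, χ (aeval v f + e) := Finset.sum_congr rfl fun e _ => hshift e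
      _ = ∑ f ∈ monicsDeg K k, ∑ e : E, χ (aeval v f + e) := Finset.sum_comm
      _ = 0 := by
          refine Finset.sum_eq_zero fun f _ => ?_
          exact (Equiv.sum_comp (Equiv.addLeft (aeval v f)) (fun e => χ e)).trans
            (MulChar.sum_eq_zero_of_ne_one hχ)
  rcases mul_eq_zero.1 h1 with h | h
  · exact absurd (Nat.cast_eq_zero.1 h) Fintype.card_ne_zero
  · exact h

lemma geom_aux (l t : ℕ) : l * ∑ u ∈ Finset.range t, (l + 1) ^ u + 1 = (l + 1) ^ t := by
  induction t with
  | zero => simp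
  | succ t ih => rw [Finset.sum_range_succ, pow_succ, ← ih]; ring

lemma prod_range_block {M : Type*} [CommMonoid M] (f : ℕ → M) (m T : ℕ) :
    ∏ j ∈ Finset.range (m * T), f j = ∏ u ∈ Finset.range T, ∏ i ∈ Finset.range m, f (m * u + i) := by
  induction T with
  | zero => simp
  | succ T ih => rw [Nat.mul_succ, Finset.prod_range_add, Finset.prod_range_succ, ih]

open IntermediateField in
lemma lam_bound_ext {K E k : Type*} [Field K] [Fintype K] [Field E] [Fintype E] [Algebra K E]
    [Field k] [Fintype k] [Algebra K k] [Algebra E k] [IsScalarTower K E k]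
    (χ : MulChar E ℂ) (hχ : χ ≠ 1) (v : E) (hv : K⟮v⟯ = ⊤) (q m t D0 : ℕ)
    (hq : Fintype.card K = q) (hq3 : 3 ≤ q) (hm : Module.finrank K E = m) (ht : 1 ≤ t)
    (hk : Module.finrank E k = 2 * t) (hD0 : D0 = 1 + ∑ i ∈ Finset.Ico 1 m, q ^ i) :
    ‖lamSum (K := K) (evChar χ v) (m * (2 * t))‖
      ≤ ((2 * (q ^ m) * (3 * D0 + 5) + D0 : ℕ) : ℝ) * ((q : ℝ) ^ m) ^ t := by
  classical
  obtain ⟨p, hchar⟩ := CharP.exists K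
  obtain ⟨e, hp, hpe⟩ := FiniteField.card K p
  have := Fact.mk hp
  have hchark : CharP k p := charP_of_injective_algebraMap (algebraMap K k).injective p
  have hintg : IsIntegral K v := Algebra.IsIntegral.isIntegral v
  have hmv : (minpoly K v).natDegree = m := by
    rw [← adjoin.finrank hintg, hv, finrank_top', hm]
  have hm1 : 1 ≤ m := by rw [← hm]; exact Module.finrank_pos
  obtain ⟨s, hs⟩ : ∃ s, s = (q ^ m) ^ t := ⟨_, rfl⟩
  have hqm : 3 ≤ q ^ m := hq3.trans (Nat.le_self_pow (by omega) q)
  have hs3 : 3 ≤ s := hs ▸ hqm.trans (Nat.le_self_pow (by omega) _)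
  have hsp : s = p ^ ((e : ℕ) * m * t) := by
    rw [hs, ← hq, hpe, pow_mul, pow_mul]
  have hrk : Module.finrank K k = m * (2 * t) := by
    rw [← hm, ← hk, Module.finrank_mul_finrank]
  have hcardk : Fintype.card k = s ^ 2 := by
    rw [Module.card_eq_pow_finrank (K := K), hrk, hq, hs]; ring
  have hcardE : Fintype.card E = q ^ m := by
    rw [Module.card_eq_pow_finrank (K := K), hm, hq]
  -- exponents
  obtain ⟨l, hl⟩ : ∃ l, l = q ^ m - 1 := ⟨_, rfl⟩
  obtain ⟨e0, he0⟩ : ∃ e0, e0 = ∑ u ∈ Finset.range t, (q ^ m) ^ u := ⟨_, rfl⟩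
  have hle : l * e0 = s - 1 := by
    have hl1 : q ^ m = l + 1 := by omega
    rw [he0, hs, hl1, ← geom_aux l t]
    rfl
  have he0s : e0 * (s + 1) = ∑ u ∈ Finset.range (2 * t), (q ^ m) ^ u := by
    rw [two_mul, Finset.sum_range_add, ← he0, mul_add, mul_one, add_comm, he0, Finset.sum_mul]
    congr 1
    refine Finset.sum_congr rfl fun u _ => ?_
    rw [hs, pow_add]; ring
  set v' : k := algebraMap E k v with hv'
  have hv'q : ∀ u, v' ^ (q ^ m) ^ u = v' := by
    intro u
    rw [hv', ← map_pow, ← hcardE, FiniteField.pow_card_pow]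
  have hfrob : ∀ (x y : k) (j : ℕ), (x - y) ^ q ^ j = x ^ q ^ j - y ^ q ^ j := by
    intro x y j
    rw [← hq, hpe, ← pow_mul, sub_pow_char_pow]
  let g1 : k[X] := - ∏ i ∈ Finset.Ico 1 m, (C v' - (X + C v') ^ q ^ i)
  obtain ⟨g, hg⟩ : ∃ g, g = X * g1 := ⟨_, rfl⟩
  have hg1 : g1.eval 0 ≠ 0 := by
    simp only [g1, eval_neg, eval_prod, neg_ne_zero, Finset.prod_ne_zero_iff, Finset.mem_Ico]
    rintro i ⟨h1, h2⟩
    simp only [eval_sub, eval_C, eval_pow, eval_add, eval_X, zero_add]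
    rw [sub_ne_zero, hv', ← map_pow]
    intro h
    refine frob_pow_ne (K := K) v i h1 (by omega) ?_
    rw [hq]
    exact ((algebraMap E k).injective h).symm
  have hgdeg : g.natDegree ≤ D0 := by
    rw [hg, hD0]
    refine natDegree_mul_le.trans (add_le_add natDegree_X_le ?_)
    simp only [g1, natDegree_neg]
    refine (natDegree_prod_le _ _).trans (Finset.sum_le_sum fun i _ => ?_)
    refine (natDegree_sub_le _ _).trans (max_le (by simp) ?_)
    refine natDegree_pow_le.trans ?_
    rw [natDegree_X_add_C, mul_one]
  have hgev : ∀ a : k, g.eval (a - v') = ∏ i ∈ Finset.range m, (v' - a ^ q ^ i) := by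
    intro a
    rw [Finset.range_eq_Ico, Finset.prod_eq_prod_Ico_succ_bot (by omega), hg]
    simp only [g1, eval_mul, eval_X, eval_neg, eval_prod, eval_sub, eval_C, eval_pow, eval_add, sub_add_cancel,
      pow_zero, pow_one, zero_add]
    ring
  let z : k → E := fun a => (aeval v (minpoly K a)) ^ (m * (2 * t) / (minpoly K a).natDegree)
  have hz : ∀ a, algebraMap E k (z a) = (g.eval (a - v')) ^ (e0 * (s + 1)) := by
    intro a
    have h1 : algebraMap E k (z a) = (aeval v' (minpoly K a)) ^ (m * (2 * t) / (minpoly K a).natDegree) := by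
      simp only [z, map_pow]
      rw [hv', aeval_algebraMap_apply]
    rw [h1, minpoly_eval_prod a v' _ hrk, prod_range_block, he0s, ← Finset.prod_pow_eq_pow_sum, hq]
    refine Finset.prod_congr rfl fun u _ => ?_
    rw [hgev, ← Finset.prod_pow]
    refine Finset.prod_congr rfl fun i _ => ?_
    rw [← pow_mul q, hfrob, pow_mul q, hv'q, ← pow_mul, ← pow_mul, ← pow_add, add_comm]
  let N : E → ℕ := fun ζ => (Finset.univ.filter (fun a : k => z a = ζ)).card
  have hNle : ∀ ζ, ζ ≠ 0 → N ζ ≤ e0 * s + (3 * D0 + 5) * s := by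
    intro ζ hζ
    have h1 := stepanov_bound p _ s l e0 hsp hs3 hcardk hle g g1 hg hg1 (algebraMap E k ζ)
      (by simpa using hζ)
    refine le_trans ?_ (h1.trans ?_)
    · refine Finset.card_le_card_of_injOn (fun a => a - v') ?_ (fun a _ b _ h => sub_left_injective h)
      intro a ha
      simp only [Finset.coe_filter, Finset.mem_univ, true_and, Set.mem_ofPred_eq] at ha ⊢
      rw [← hz, ha]
    · gcongr
  have hg0 : g ≠ 0 := by
    rw [hg]
    refine mul_ne_zero X_ne_zero ?_
    intro h; rw [h] at hg1; simp at hg1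
  have hN0 : N 0 ≤ D0 := by
    refine le_trans ?_ (((Multiset.toFinset_card_le _).trans (card_roots' g)).trans hgdeg)
    refine Finset.card_le_card_of_injOn (fun a => a - v') ?_ (fun a _ b _ h => sub_left_injective h)
    intro a ha
    simp only [Finset.coe_filter, Finset.mem_univ, true_and, Set.mem_ofPred_eq] at ha
    have := hz a
    rw [ha, map_zero] at this
    rw [Finset.mem_coe, Multiset.mem_toFinset, mem_roots hg0, IsRoot.def]
    exact eq_zero_of_pow_eq_zero this.symm
  have hNsum : ∑ ζ, N ζ = s ^ 2 := by
    rw [← hcardk, ← Finset.card_univ]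
    exact (Finset.card_eq_sum_card_fiberwise (fun a _ => Finset.mem_coe.2 (Finset.mem_univ _))).symm
  have hlam : lamSum (K := K) (evChar χ v) (m * (2 * t)) = ∑ ζ : E, (N ζ : ℂ) * χ ζ := by
    rw [lamSum_eq (K := K) (evChar χ v) (k := k) _ hrk]
    have h1 : ∀ a : k, (evChar χ v (minpoly K a)) ^ (m * (2 * t) / (minpoly K a).natDegree) = χ (z a) := by
      intro a
      rw [evChar_apply, ← map_pow]
    rw [Finset.sum_congr rfl (fun a _ => h1 a), ← Finset.sum_fiberwise (s := Finset.univ) (g := z)]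
    refine Finset.sum_congr rfl fun ζ _ => ?_
    rw [Finset.sum_congr rfl (g := fun _ => χ ζ)
      (fun a ha => by rw [Finset.mem_filter] at ha; rw [ha.2])]
    rw [Finset.sum_const, nsmul_eq_mul]
  have hlam2 : lamSum (K := K) (evChar χ v) (m * (2 * t))
      = ∑ ζ ∈ Finset.univ.erase (0 : E), (((N ζ : ℝ) - e0 * s : ℝ) : ℂ) * χ ζ := by
    have h0 : ∑ ζ : E, χ ζ = 0 := MulChar.sum_eq_zero_of_ne_one hχ
    have h1 : ∑ ζ : E, (((N ζ : ℝ) - e0 * s : ℝ) : ℂ) * χ ζ = ∑ ζ : E, (N ζ : ℂ) * χ ζ := by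
      push_cast
      simp_rw [sub_mul]
      rw [Finset.sum_sub_distrib, ← Finset.mul_sum, h0, mul_zero, sub_zero]
    rw [hlam, ← h1, ← Finset.add_sum_erase _ _ (Finset.mem_univ (0 : E)), MulChar.map_zero, mul_zero, zero_add]
  rw [hlam2]
  have hchi : ∀ ζ : E, ‖χ ζ‖ ≤ 1 := by
    intro ζ
    by_cases h : ζ = 0
    · rw [h, MulChar.map_zero, norm_zero]; exact zero_le_one
    · have h1 : (χ ζ) ^ (Fintype.card E - 1) = 1 := by
        rw [← map_pow, FiniteField.pow_card_sub_one_eq_one ζ h, map_one]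
      exact (Complex.norm_eq_one_of_pow_eq_one h1 (by rw [hcardE]; omega)).le
  have hcarder : (Finset.univ.erase (0 : E)).card = l := by
    rw [Finset.card_erase_of_mem (Finset.mem_univ _), Finset.card_univ, hcardE, hl]
  obtain ⟨M, hM⟩ : ∃ M : ℝ, M = (3 * D0 + 5) * s := ⟨_, rfl⟩
  have habs : ∀ ζ ∈ Finset.univ.erase (0 : E), |(N ζ : ℝ) - e0 * s| ≤ 2 * M - ((N ζ : ℝ) - e0 * s) := by
    intro ζ hζ
    have h1 : (N ζ : ℝ) ≤ e0 * s + (3 * D0 + 5) * s := by exact_mod_cast hNle ζ (Finset.ne_of_mem_erase hζ)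
    have hM0 : 0 ≤ M := by rw [hM]; positivity
    rw [abs_le]
    constructor <;> linarith
  calc _ ≤ ∑ ζ ∈ Finset.univ.erase (0 : E), |(N ζ : ℝ) - e0 * s| := by
        refine (norm_sum_le _ _).trans (Finset.sum_le_sum fun ζ _ => ?_)
        rw [norm_mul, Complex.norm_real, Real.norm_eq_abs]
        exact mul_le_of_le_one_right (abs_nonneg _) (hchi ζ)
    _ ≤ ∑ ζ ∈ Finset.univ.erase (0 : E), (2 * M - ((N ζ : ℝ) - e0 * s)) := Finset.sum_le_sum habs
    _ = l * (2 * M) + l * (e0 * s) - ∑ ζ ∈ Finset.univ.erase (0 : E), (N ζ : ℝ) := by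
        simp only [Finset.sum_sub_distrib, Finset.sum_const, hcarder, nsmul_eq_mul]
        ring
    _ ≤ l * (2 * M) + D0 := by
        have h1 : (N 0 : ℝ) + ∑ ζ ∈ Finset.univ.erase (0 : E), (N ζ : ℝ) = (s : ℝ) ^ 2 := by
          rw [Finset.add_sum_erase _ (fun ζ => (N ζ : ℝ)) (Finset.mem_univ (0 : E))]
          exact_mod_cast hNsum
        have h2 : (N 0 : ℝ) ≤ D0 := by exact_mod_cast hN0
        have h3 : (l : ℝ) * e0 = s - 1 := by
          have : ((l * e0 : ℕ) : ℝ) = ((s - 1 : ℕ) : ℝ) := by rw [hle]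
          rw [Nat.cast_sub (by omega)] at this
          push_cast at this
          exact this
        have h4 : (l : ℝ) * (e0 * s) = (s - 1) * s := by rw [← h3]; ring
        have h5 : (0 : ℝ) ≤ s := Nat.cast_nonneg _
        nlinarith
    _ ≤ _ := by
        have hsr : ((q : ℝ) ^ m) ^ t = s := by rw [hs]; push_cast; rfl
        have hlr : (l : ℝ) ≤ (q : ℝ) ^ m := by
          have : l ≤ q ^ m := by omega
          exact_mod_cast this
        have hs1 : (1 : ℝ) ≤ s := by exact_mod_cast (by omega : 1 ≤ s)
        rw [hsr, hM]
        push_cast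
        have h6 : (l : ℝ) * (2 * ((3 * D0 + 5) * s)) ≤ (q : ℝ) ^ m * (2 * ((3 * D0 + 5) * s)) := by gcongr
        have h7 : (D0 : ℝ) ≤ D0 * s := le_mul_of_one_le_right (Nat.cast_nonneg _) hs1
        linarith

open IntermediateField in
/-- Katz bound over finite fields. -/
lemma katz_bound {K E : Type*} [Field K] [Fintype K] [Field E] [Fintype E] [Algebra K E]
    (χ : MulChar E ℂ) (hχ : χ ≠ 1) (v : E) (hv : K⟮v⟯ = ⊤) (q m : ℕ)
    (hq : Fintype.card K = q) (hq3 : 3 ≤ q) (hm : Module.finrank K E = m) :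
    ‖∑ a : K, χ (v - algebraMap K E a)‖ ≤ ((m : ℝ) - 1) * √q := by
  classical
  have hm1 : 1 ≤ m := by rw [← hm]; exact Module.finrank_pos
  obtain ⟨S, hScard, hS⟩ := newton_roots (cSum (K := K) (evChar χ v)) (lamSum (K := K) (evChar χ v)) (m - 1)
    (by
      have : monicsDeg K 0 = {1} := by
        ext f
        rw [mem_monicsDeg, Finset.mem_singleton]
        constructor
        · rintro ⟨h1, h2⟩; exact h1.natDegree_eq_zero.1 h2
        · rintro rfl; exact ⟨monic_one, natDegree_one⟩
      rw [cSum, this, Finset.sum_singleton, map_one])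
    (fun k hk => csum_zero χ hχ v hv k (by omega))
    (newton_identity _)
  have hq0 : (0 : ℝ) < q := by exact_mod_cast (by omega : 0 < q)
  obtain ⟨C, hC⟩ : ∃ C : ℝ, ∀ t : ℕ, 1 ≤ t →
      ‖lamSum (K := K) (evChar χ v) (m * (2 * t))‖ ≤ C * ((q : ℝ) ^ m) ^ t := by
    refine ⟨((2 * (q ^ m) * (3 * (1 + ∑ i ∈ Finset.Ico 1 m, q ^ i) + 5) +
      (1 + ∑ i ∈ Finset.Ico 1 m, q ^ i) : ℕ) : ℝ), fun t ht => ?_⟩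
    obtain ⟨p, hchar⟩ := CharP.exists E
    obtain ⟨e, hp, hpe⟩ := FiniteField.card E p
    have := Fact.mk hp
    have : NeZero (2 * t) := ⟨by omega⟩
    letI : Algebra K (FiniteField.Extension E p (2 * t)) :=
      ((algebraMap E (FiniteField.Extension E p (2 * t))).comp (algebraMap K E)).toAlgebra
    haveI : IsScalarTower K E (FiniteField.Extension E p (2 * t)) := IsScalarTower.of_algebraMap_eq (fun _ => rfl)
    letI := Fintype.ofFinite (FiniteField.Extension E p (2 * t))
    exact lam_bound_ext (k := FiniteField.Extension E p (2 * t)) χ hχ v hv q m t _ hq hq3 hm ht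
      (FiniteField.finrank_extension E p (2 * t)) rfl
  have hroots : ∀ α ∈ S, ‖α‖ ≤ √q := by
    have h1 := powersum_bound (S.map (fun α => α ^ (m * 2))) ((q : ℝ) ^ m) C (by positivity) (by
      intro t ht
      have h2 := hC t ht
      rw [hS _ (by have := Nat.mul_pos hm1 (by omega : 0 < 2 * t); omega), norm_neg] at h2
      have h9 : ((fun β : ℂ => β ^ t) ∘ fun α : ℂ => α ^ (m * 2)) = fun α => α ^ (m * (2 * t)) := by
        funext α
        simp only [Function.comp]
        rw [← pow_mul, mul_assoc]
      rw [Multiset.map_map, h9]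
      exact h2)
    intro α hα
    have h3 := h1 (α ^ (m * 2)) (Multiset.mem_map_of_mem _ hα)
    rw [norm_pow] at h3
    have h4 : (q : ℝ) ^ m = (√q) ^ (m * 2) := by
      rw [mul_comm, pow_mul, Real.sq_sqrt hq0.le]
    rw [h4] at h3
    exact le_of_pow_le_pow_left₀ (by omega) (Real.sqrt_nonneg _) h3
  have hlam1 : lamSum (K := K) (evChar χ v) 1 = ∑ a : K, χ (v - algebraMap K E a) := by
    rw [lamSum_eq (K := K) (evChar χ v) (k := K) 1 (Module.finrank_self K)]
    refine Finset.sum_congr rfl fun a _ => ?_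
    have : minpoly K a = X - Polynomial.C a := minpoly.eq_X_sub_C' a
    rw [this, natDegree_X_sub_C, Nat.div_one, pow_one, evChar_apply]
    simp
  rw [← hlam1, hS 1 le_rfl, norm_neg]
  simp only [pow_one, Multiset.map_id']
  have h5 : ‖S.sum‖ ≤ (S.map (fun α => ‖α‖)).sum := norm_multiset_sum_le S
  have h6 : (S.map (fun α => ‖α‖)).sum ≤ (S.map (fun α => ‖α‖)).card • √q :=
    Multiset.sum_le_card_nsmul _ _ (by
      intro x hx
      obtain ⟨α, hα, rfl⟩ := Multiset.mem_map.1 hx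
      exact hroots α hα)
  rw [Multiset.card_map, nsmul_eq_mul] at h6
  have h7 : (S.card : ℝ) ≤ (m : ℝ) - 1 := by
    have : S.card + 1 ≤ m := by omega
    have : ((S.card + 1 : ℕ) : ℝ) ≤ m := by exact_mod_cast this
    push_cast at this
    linarith
  exact h5.trans (h6.trans (mul_le_mul_of_nonneg_right h7 (Real.sqrt_nonneg _)))

open IntermediateField in
/-- Theorem 1.2 / `main1`: Let `d > 1`, let `q` be a power of an odd
prime, and `n ≥ 2` with `q ^ n ≡ 1 (mod 2d)` and `q > (n-1)^2`.  If the subfield `𝔽_q`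
of `𝔽_{q^n}` is a maximal subfield clique in the `d`-Paley graph `GP(q^n, d)`, then
`𝔽_q` is a maximal clique in `GP(q^n, d)`. -/
theorem subfield_maximal_clique_in_generalized_Paley
    (p q d n kp : ℕ) (hp : p.Prime) (hpodd : Odd p) (hkp : 1 ≤ kp) (hq : q = p ^ kp)
    (hd : 1 < d) (hn : 2 ≤ n)
    (hmod : q ^ n ≡ 1 [MOD 2 * d]) (hqbig : (n - 1) ^ 2 < q)
    (F : Type*) [Field F] [Fintype F] (hF : Fintype.card F = q ^ n)
    (K : Subfield F) (hK : Nat.card K = q)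
    (G : SimpleGraph F)
    (hG : ∀ x y : F, G.Adj x y ↔ x ≠ y ∧ ∃ z : F, z ≠ 0 ∧ x - y = z ^ d)
    (hclique : G.IsClique (K : Set F))
    (hmaxsub : ∀ K' : Subfield F, (K : Set F) ⊆ (K' : Set F) →
      G.IsClique (K' : Set F) → K' = K) :
    ∀ C : Set F, (K : Set F) ⊆ C → G.IsClique C → C = (K : Set F) := by
  classical
  intro C hKC hC
  refine Set.Subset.antisymm ?_ hKC
  intro v hvC
  by_contra hvK
  have hvK' : v ∉ K := hvK
  letI : Fintype K := Fintype.ofFinite K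
  have hcardK : Fintype.card K = q := by rw [← Nat.card_eq_fintype_card, hK]
  have hq3 : 3 ≤ q := by
    have h3 : 3 ≤ p := by
      have := hp.two_le
      rcases hpodd with ⟨c, hc⟩
      omega
    rw [hq]; exact h3.trans (Nat.le_self_pow (by omega) p)
  have hnF : Module.finrank K F = n := by
    have h1 := Module.card_eq_pow_finrank (K := K) (V := F)
    rw [hcardK, hF] at h1
    exact (Nat.pow_right_injective (by omega : 2 ≤ q) h1).symm
  let E : IntermediateField K F := K⟮v⟯
  have hvE : v ∈ E := mem_adjoin_simple_self K v
  letI : Fintype E := Fintype.ofFinite E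
  let H : Subgroup Eˣ :=
    { carrier := {x | ∃ z : F, z ≠ 0 ∧ ((x : E) : F) = z ^ d}
      one_mem' := ⟨1, one_ne_zero, by simp⟩
      mul_mem' := by
        rintro x y ⟨z, hz, hx⟩ ⟨w, hw, hy⟩
        refine ⟨z * w, mul_ne_zero hz hw, ?_⟩
        rw [mul_pow, ← hx, ← hy]; simp
      inv_mem' := by
        rintro x ⟨z, hz, hx⟩
        refine ⟨z⁻¹, inv_ne_zero hz, ?_⟩
        rw [inv_pow, ← hx]; simp }
  by_cases hH : ∀ x : Eˣ, x ∈ H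
  · have hEK : E.toSubfield = K := by
      refine hmaxsub E.toSubfield ?_ ?_
      · intro x hx
        exact E.algebraMap_mem ⟨x, hx⟩
      · intro x hx y hy hxy
        rw [hG]
        refine ⟨hxy, ?_⟩
        have hxyE : x - y ∈ E := E.sub_mem hx hy
        have hne : (⟨x - y, hxyE⟩ : E) ≠ 0 := by
          intro h
          exact sub_ne_zero.2 hxy (congrArg Subtype.val h)
        exact hH (Units.mk0 _ hne)
    exact hvK' (hEK ▸ hvE)
  · push Not at hH
    obtain ⟨x, hx⟩ := hH
    have hx1 : (QuotientGroup.mk x : Eˣ ⧸ H) ≠ 1 := by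
      rwa [Ne, QuotientGroup.eq_one_iff]
    obtain ⟨ψ, hψ⟩ := CommGroup.exists_apply_ne_one_of_hasEnoughRootsOfUnity (Eˣ ⧸ H) ℂ hx1
    let χ : MulChar E ℂ := MulChar.ofUnitHom (ψ.comp (QuotientGroup.mk' H))
    have hχ : χ ≠ 1 := by
      intro h
      have h1 : χ (x : E) = 1 := by rw [h, MulChar.one_apply_coe]
      rw [MulChar.ofUnitHom_coe] at h1
      exact hψ (Units.ext h1)
    have hχH : ∀ y ∈ H, χ (y : E) = 1 := by
      intro y hy
      rw [MulChar.ofUnitHom_coe, MonoidHom.comp_apply, QuotientGroup.mk'_apply,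
        (QuotientGroup.eq_one_iff y).2 hy, map_one, Units.val_one]
    have hgen : K⟮(⟨v, hvE⟩ : E)⟯ = ⊤ := by
      apply lift_injective E
      rw [lift_adjoin_simple, lift_top]
    have hkatz := katz_bound (K := K) χ hχ (⟨v, hvE⟩ : E) hgen q (Module.finrank K E) hcardK hq3 rfl
    have hsum : ∑ a : K, χ ((⟨v, hvE⟩ : E) - algebraMap K E a) = q := by
      have h1 : ∀ a : K, χ ((⟨v, hvE⟩ : E) - algebraMap K E a) = 1 := by
        intro a
        have hva : v ≠ (a : F) := by rintro rfl; exact hvK' a.2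
        have hadj := (hG v a).1 (hC hvC (hKC a.2) hva)
        have hne : ((⟨v, hvE⟩ : E) - algebraMap K E a) ≠ 0 := by
          intro h
          exact sub_ne_zero.2 hva (congrArg Subtype.val h)
        exact hχH (Units.mk0 _ hne) hadj.2
      rw [Finset.sum_congr rfl (fun a _ => h1 a), Finset.sum_const, Finset.card_univ, hcardK]
      simp
    rw [hsum, Complex.norm_natCast] at hkatz
    have hle : Module.finrank K E ≤ n := by
      rw [← hnF]
      exact Submodule.finrank_le E.toSubalgebra.toSubmodule
    have hqpos : (0 : ℝ) < q := by exact_mod_cast (by omega : 0 < q)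
    have hsq : √(q : ℝ) * √q = q := Real.mul_self_sqrt hqpos.le
    have hsp : 0 < √(q : ℝ) := Real.sqrt_pos.2 hqpos
    have h2 : √(q : ℝ) ≤ (n : ℝ) - 1 := by
      have h3 : (Module.finrank K E : ℝ) ≤ n := by exact_mod_cast hle
      have h4 : √(q : ℝ) * √q ≤ ((n : ℝ) - 1) * √q := by
        rw [hsq]
        refine hkatz.trans ?_
        gcongr
      exact le_of_mul_le_mul_right h4 hsp
    have h5 : (((n - 1) ^ 2 : ℕ) : ℝ) < q := by exact_mod_cast hqbig
    rw [Nat.cast_pow, Nat.cast_sub (by omega), Nat.cast_one] at h5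
    nlinarith
end

section
/- Let $d \geq 4$ be an even integer, let $q$ be a power of an odd prime, and let $n \geq 2$ be an integer such that $q^n \equiv 1 \pmod{2d}$ and $q > (n-1)^2 d^4 / (\pi^2 (d-1)^2)$. If the subfield $\mathbb{F}_q$ of $\mathbb{F}_{q^n}$ is a maximal subfield clique in the generalized Peisert graph $GP^*(q^n, d)$, then $\mathbb{F}_q$ is also a maximal clique in $GP^*(q^n, d)$. -/
section Helpers
open Polynomial
set_option linter.unusedSectionVars false

lemma stepanov_aux {E : Type*} [Field E] (P d D c B J : ℕ) (f : E[X]) (hfD : f.natDegree = D)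
    (hP : P = d * c + 1) (ζ : E) (hdim : P * B + D * P + J < d * J * B) :
    ∃ κ : Fin d × Fin J → E[X], κ ≠ 0 ∧ (∀ x, (κ x).degree < B) ∧
      ∑ x, expand E P (κ x) * (C (ζ ^ (x.1 : ℕ)) * f ^ ((d - x.1) * c) * X ^ (x.2 : ℕ)) = 0 := by
  have hP0 : 0 < P := by omega
  let Φ : (Fin d × Fin J → degreeLT E B) →ₗ[E] degreeLT E (P * B + D * P + J) :=
    LinearMap.codRestrict _
      (∑ x : Fin d × Fin J,
        (LinearMap.mulRight E (C (ζ ^ (x.1 : ℕ)) * f ^ ((d - x.1) * c) * X ^ (x.2 : ℕ))) ∘ₗ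
        (expand E P).toLinearMap ∘ₗ (degreeLT E B).subtype ∘ₗ LinearMap.proj x) (by
      intro κ
      rw [LinearMap.sum_apply]
      refine Submodule.sum_mem _ fun x _ => ?_
      simp only [LinearMap.comp_apply, LinearMap.mulRight_apply, AlgHom.toLinearMap_apply,
        Submodule.subtype_apply, LinearMap.proj_apply]
      by_cases h0 : (κ x : E[X]) = 0
      · simp [h0]
      have hk := (mem_degreeLT.1 (κ x).2)
      rw [degree_eq_natDegree h0] at hk
      have hk' : (κ x : E[X]).natDegree < B := by exact_mod_cast hk
      rw [mem_degreeLT]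
      refine lt_of_le_of_lt degree_le_natDegree ?_
      have h1 : (expand E P (κ x : E[X]) * (C (ζ ^ (x.1 : ℕ)) * f ^ ((d - x.1) * c) * X ^ (x.2 : ℕ))).natDegree
          ≤ (κ x : E[X]).natDegree * P + (0 + ((d - x.1) * c) * D + x.2) := by
        refine natDegree_mul_le.trans (add_le_add (by rw [natDegree_expand]) ?_)
        refine natDegree_mul_le.trans (add_le_add ?_ (natDegree_X_pow_le _))
        refine natDegree_mul_le.trans (add_le_add (natDegree_C _).le ?_)
        exact natDegree_pow_le.trans (by rw [hfD])
      have h2 : ((d - (x.1 : ℕ)) * c) * D ≤ D * P := by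
        rw [mul_comm]
        refine Nat.mul_le_mul_left _ ?_
        rw [hP]
        have : (d - (x.1 : ℕ)) * c ≤ d * c := Nat.mul_le_mul_right _ (Nat.sub_le _ _)
        omega
      have h3 : (κ x : E[X]).natDegree * P ≤ P * B := by
        rw [mul_comm]; exact Nat.mul_le_mul_left _ hk'.le
      have h4 := x.2.2
      exact_mod_cast (by omega : _ < P * B + D * P + J))
  have hker : LinearMap.ker Φ ≠ ⊥ := by
    apply LinearMap.ker_ne_bot_of_finrank_lt
    rw [Module.finrank_pi_fintype]
    simp only [LinearEquiv.finrank_eq (degreeLTEquiv E _), Module.finrank_fin_fun]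
    simpa using hdim
  obtain ⟨κ, hκ, hκ0⟩ := Submodule.exists_mem_ne_zero_of_ne_bot hker
  refine ⟨fun x => (κ x : E[X]), ?_, fun x => mem_degreeLT.1 (κ x).2, ?_⟩
  · intro h
    apply hκ0
    ext1 x
    exact Subtype.ext (congrFun h x)
  · have := congrArg Subtype.val (LinearMap.mem_ker.1 hκ)
    simpa [Φ, LinearMap.sum_apply, mul_assoc] using this

lemma stepanov {E : Type*} [Field E] [Fintype E] [DecidableEq E] (P P' d D c c' : ℕ) (hd : 2 ≤ d)
    (hP : P = d * c + 1) (hP' : P' = d * c' + 1) (hcard : Fintype.card E = P * P')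
    (f : E[X]) (hfD : f.natDegree = D) (hD : D < d) (hcop : Nat.Coprime d D)
    (hf : ∀ a, f.eval (a ^ P) = (f.eval a) ^ P)
    (hinj : Function.Injective (fun a : E => a ^ P)) (hsize : P + c + 3 ≤ c')
    (ζ : E) (hζ : ζ ≠ 0) :
    (Finset.univ.filter (fun a : E => f.eval a ^ (P * c' + c) = ζ)).card ≤ c * P' + (D + 4) * P' := by
  have hdc : 2 * c ≤ d * c := Nat.mul_le_mul_right _ hd
  obtain ⟨κ, hκ0, hκd, hκ⟩ := stepanov_aux P d D c P (c + 4) f hfD hP ζ (by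
    have h1 : d * (c + 4) * P = (P - 1) * P + 4 * d * P := by rw [hP]; simp; ring
    obtain ⟨P0, rfl⟩ : ∃ P0, P = P0 + 1 := ⟨d * c, hP⟩
    simp only [Nat.add_sub_cancel] at h1
    rw [h1]
    have : D * (P0 + 1) + (P0 + 1) ≤ d * (P0 + 1) := by
      have := Nat.mul_le_mul_right (P0 + 1) hD; linarith
    nlinarith [Nat.mul_le_mul_right (P0 + 1) hd])
  have hf0 : f ≠ 0 := by
    rintro rfl
    simp at hfD
    subst hfD
    simp at hcop
    omega
  have hdegx : ∀ x, κ x ≠ 0 → (κ x * (f ^ ((x.1 : ℕ) * c') * X ^ ((x.2 : ℕ) * P'))).degree =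
      ((c' * (D * x.1 + d * x.2) + x.2 + (κ x).natDegree : ℕ) : WithBot ℕ) := by
    intro x hx
    rw [degree_eq_natDegree (by simp [hx, hf0])]
    rw [natDegree_mul hx (by simp [hf0]), natDegree_mul (by simp [hf0]) (by simp), natDegree_pow,
      natDegree_X_pow, hfD, hP']
    congr 1
    ring
  have hκn : ∀ x, κ x ≠ 0 → (κ x).natDegree < P := by
    intro x hx
    have := hκd x
    rw [degree_eq_natDegree hx] at this
    exact_mod_cast this
  set R : E[X] := ∑ x, κ x * (f ^ ((x.1 : ℕ) * c') * X ^ ((x.2 : ℕ) * P')) with hR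
  have hdegR := degree_sum_eq_of_disjoint
    (fun x => κ x * (f ^ ((x.1 : ℕ) * c') * X ^ ((x.2 : ℕ) * P'))) Finset.univ (by
      intro x hx y hy hxy hdeg
      apply hxy
      have hx0 : κ x ≠ 0 := fun h => hx.2 (by simp [h])
      have hy0 : κ y ≠ 0 := fun h => hy.2 (by simp [h])
      simp only [Function.comp] at hdeg
      rw [hdegx x hx0, hdegx y hy0] at hdeg
      have hdeg' : c' * (D * x.1 + d * x.2) + x.2 + (κ x).natDegree =
        c' * (D * y.1 + d * y.2) + y.2 + (κ y).natDegree := by exact_mod_cast hdeg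
      have hx1 := hκn x hx0
      have hy1 := hκn y hy0
      have hx2 := x.2.2
      have hy2 := y.2.2
      have hu : D * (x.1 : ℕ) + d * x.2 = D * y.1 + d * y.2 := by
        have e1 := Nat.div_mod_unique (b := c') (a := c' * (D * x.1 + d * x.2) + x.2 + (κ x).natDegree)
          (c := (x.2 : ℕ) + (κ x).natDegree) (d := D * x.1 + d * x.2) (by omega)
        have e2 := Nat.div_mod_unique (b := c') (a := c' * (D * x.1 + d * x.2) + x.2 + (κ x).natDegree)
          (c := (y.2 : ℕ) + (κ y).natDegree) (d := D * y.1 + d * y.2) (by omega)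
        have := (e1.2 ⟨by ring, by omega⟩).1
        have := (e2.2 ⟨by rw [hdeg']; ring, by omega⟩).1
        omega
      have h1 : (x.1 : ℕ) = y.1 := by
        have : D * (x.1 : ℕ) ≡ D * y.1 [MOD d] := by
          have : (D * (x.1 : ℕ) + d * x.2) % d = (D * y.1 + d * y.2) % d := by rw [hu]
          simpa [Nat.ModEq] using this
        have := Nat.ModEq.cancel_left_of_coprime hcop this
        exact Nat.ModEq.eq_of_lt_of_lt this x.1.2 y.1.2
      have h2 : (x.2 : ℕ) = y.2 := by
        rw [h1] at hu
        have : d * (x.2 : ℕ) = d * y.2 := by omega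
        exact Nat.eq_of_mul_eq_mul_left (by omega) this
      exact Prod.ext (Fin.ext h1) (Fin.ext h2))
  have hR0 : R ≠ 0 := by
    obtain ⟨x, hx⟩ := Function.ne_iff.1 hκ0
    intro h
    rw [← hR, h, degree_zero] at hdegR
    have := Finset.le_sup (f := fun x => (κ x * (f ^ ((x.1 : ℕ) * c') * X ^ ((x.2 : ℕ) * P'))).degree)
      (Finset.mem_univ x)
    rw [← hdegR, hdegx x hx, le_bot_iff] at this
    exact WithBot.coe_ne_bot this
  have hRd : R.natDegree ≤ c * P' + (D + 4) * P' := by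
    rw [natDegree_le_iff_degree_le, hR, hdegR]
    refine Finset.sup_le fun x _ => ?_
    by_cases hx : κ x = 0
    · simp [hx]
    rw [hdegx x hx]
    have hx1 := hκn x hx
    have hx2 := x.2.2
    have h1 : c' * (D * x.1 + d * x.2) + x.2 = D * (c' * x.1) + x.2 * P' := by rw [hP']; ring
    have h2 : D * (c' * x.1) ≤ D * P' := by
      apply Nat.mul_le_mul_left
      rw [hP', mul_comm]
      have := Nat.mul_le_mul_right c' x.1.2.le
      omega
    have h3 : (x.2 : ℕ) * P' ≤ (c + 3) * P' := Nat.mul_le_mul_right _ (by omega)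
    have h4 : P ≤ P' := by rw [hP']; nlinarith
    have : c' * (D * x.1 + d * x.2) + x.2 + (κ x).natDegree ≤ c * P' + (D + 4) * P' := by
      nlinarith
    exact_mod_cast this
  refine le_trans ?_ hRd
  refine le_trans ?_ (card_roots' R)
  refine le_trans ?_ (Multiset.toFinset_card_le _)
  refine Finset.card_le_card_of_injOn (fun a => a ^ P) ?_ (hinj.injOn)
  intro a ha
  have ha : f.eval a ^ (P * c' + c) = ζ := by simpa using ha
  have hfa : f.eval a ≠ 0 := by
    intro h
    rw [h] at ha
    by_cases h0 : P * c' + c = 0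
    · have : c' = 0 := by nlinarith
      omega
    · rw [zero_pow h0] at ha
      exact hζ ha.symm
  simp only [Multiset.mem_toFinset, Finset.mem_coe]
  rw [mem_roots hR0, IsRoot.def]
  have key : R.eval (a ^ P) * (f.eval a) ^ (d * c) = 0 := by
    rw [← eval_zero (x := a), ← hκ, hR, eval_finsetSum, eval_finsetSum, Finset.sum_mul]
    refine Finset.sum_congr rfl fun x _ => ?_
    simp only [eval_mul, eval_pow, expand_eval, eval_C, eval_X, hf]
    rw [← ha]
    have hxP : (a ^ P) ^ ((x.2 : ℕ) * P') = a ^ (x.2 : ℕ) := by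
      rw [← pow_mul, show P * ((x.2 : ℕ) * P') = (P * P') * x.2 by ring, pow_mul, ← hcard,
        FiniteField.pow_card]
    rw [hxP]
    have hpow : (eval a f ^ P) ^ ((x.1 : ℕ) * c') * eval a f ^ (d * c) =
        (eval a f ^ (P * c' + c)) ^ (x.1 : ℕ) * eval a f ^ ((d - x.1) * c) := by
      rw [← pow_mul, ← pow_mul, ← pow_add, ← pow_add]
      congr 1
      obtain ⟨y, hy⟩ : ∃ y, d = x.1 + y := ⟨d - x.1, by have := x.1.2; omega⟩
      have : d - x.1 = y := by omega
      rw [this]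
      have hy2 : d * c = x.1 * c + y * c := by rw [← add_mul, ← hy]
      rw [hy2]
      ring
    linear_combination (eval (a ^ P) (κ x)) * a ^ (x.2 : ℕ) * hpow
  exact (mul_eq_zero.1 key).resolve_right (pow_ne_zero _ hfa)


section FieldFacts
variable {K E : Type*} [Field K] [Fintype K] [Field E] [Fintype E] [Algebra K E]

lemma frob_dvd (a : E) (i : ℕ) (h : a ^ (Fintype.card K ^ i) = a) :
    (minpoly K a).natDegree ∣ i := by
  have hIntg : IsIntegral K a := IsIntegral.of_finite K a
  refine (minpoly.irreducible hIntg).natDegree_dvd_of_dvd_X_pow_card_pow_sub_X ?_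
  apply minpoly.dvd
  rw [Nat.card_eq_fintype_card]
  simp [h]

lemma aeval_frob (f : K[X]) (a : E) (i : ℕ) :
    aeval (a ^ (Fintype.card K ^ i)) f = (aeval a f) ^ (Fintype.card K ^ i) := by
  induction i with
  | zero => simp
  | succ i ih =>
    rw [pow_succ, pow_mul, pow_mul, ← ih]
    have := Polynomial.aeval_algHom_apply (FiniteField.frobeniusAlgHom K E)
      (a ^ (Fintype.card K ^ i)) f
    simpa [FiniteField.coe_frobeniusAlgHom] using this

lemma pow_card_pow_inj (i : ℕ) : Function.Injective (fun a : E => a ^ (Fintype.card K ^ i)) := by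
  have h : Function.Injective (fun a : E => a ^ (Fintype.card K)) := by
    have := (FiniteField.frobeniusAlgHom K E).toRingHom.injective
    simpa [FiniteField.coe_frobeniusAlgHom] using! this
  induction i with
  | zero => simpa using! Function.injective_id
  | succ i ih =>
    intro a b hab
    simp only [pow_succ, pow_mul] at hab
    exact ih (h hab)

lemma frob_deg (a : E) : a ^ (Fintype.card K ^ (minpoly K a).natDegree) = a := by
  have hIntg : IsIntegral K a := IsIntegral.of_finite K a
  have := ((minpoly.irreducible hIntg).natDegree_dvd_iff_dvd_X_pow_card_pow_sub_X
    (n := (minpoly K a).natDegree)).1 dvd_rfl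
  rw [Nat.card_eq_fintype_card, minpoly.dvd_iff] at this
  simpa [sub_eq_zero] using this

lemma minpoly_map_prod (a : E) : (minpoly K a).map (algebraMap K E) =
    ∏ i ∈ Finset.range (minpoly K a).natDegree, (X - C (a ^ (Fintype.card K ^ i))) := by
  classical
  have hIntg : IsIntegral K a := IsIntegral.of_finite K a
  have hm := minpoly.monic hIntg
  refine eq_of_monic_of_dvd_of_natDegree_le
    (monic_prod_of_monic _ (fun i => X - C (a ^ (Fintype.card K ^ i))) fun i _ => monic_X_sub_C _)
    (hm.map _) ?_ ?_
  · refine Finset.prod_dvd_of_coprime ?_ ?_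
    · intro i hi j hj hij
      apply isCoprime_X_sub_C_of_isUnit_sub
      rw [isUnit_iff_ne_zero, sub_ne_zero]
      intro h
      simp only [Finset.coe_range, Set.mem_Iio] at hi hj
      wlog hlt : i < j generalizing i j
      · exact this hij.symm h.symm hj hi (by omega)
      have h1 : a ^ (Fintype.card K ^ (j - i)) = a := by
        apply pow_card_pow_inj (K := K) i
        simp only
        rw [← pow_mul, ← pow_add, h]
        congr 2; omega
      have := Nat.le_of_dvd (by omega) (frob_dvd a _ h1)
      omega
    · intro i _
      rw [dvd_iff_isRoot, IsRoot.def, eval_map_algebraMap, aeval_frob, minpoly.aeval,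
        zero_pow (pow_ne_zero _ Fintype.card_ne_zero)]
  · rw [hm.natDegree_map, natDegree_prod_of_monic _ _ fun i _ => monic_X_sub_C _]
    simp only [natDegree_X_sub_C]
    simp

lemma aeval_minpoly_pow (a w : E) :
    (aeval w (minpoly K a)) ^ (Module.finrank K E / (minpoly K a).natDegree) =
    ∏ i ∈ Finset.range (Module.finrank K E), (w - a ^ (Fintype.card K ^ i)) := by
  obtain ⟨t, ht⟩ := minpoly.degree_dvd (K := K) (x := a) (IsIntegral.of_finite K a)
  have hpos := minpoly.natDegree_pos (IsIntegral.of_finite K a)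
  rw [ht, Nat.mul_div_cancel_left _ hpos]
  have h1 : aeval w (minpoly K a) = ∏ i ∈ Finset.range (minpoly K a).natDegree,
      (w - a ^ (Fintype.card K ^ i)) := by
    rw [← eval_map_algebraMap, minpoly_map_prod, eval_prod]
    simp
  clear ht
  induction t with
  | zero => simp
  | succ t ih =>
    rw [pow_succ, ih, mul_add, mul_one, Finset.prod_range_add, h1]
    congr 1
    refine Finset.prod_congr rfl fun i _ => ?_
    rw [pow_add, pow_mul a]
    congr 2
    clear ih
    induction t with
    | zero => simp
    | succ t ih => rw [mul_add, pow_add, pow_mul, ← ih, mul_one, frob_deg]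

lemma card_minpoly_eq [DecidableEq K[X]] (π : K[X]) (hm : π.Monic) (hi : Irreducible π)
    (hd : π.natDegree ∣ Module.finrank K E) :
    (Finset.univ.filter (fun a : E => minpoly K a = π)).card = π.natDegree := by
  classical
  have hcard : Fintype.card E = Fintype.card K ^ Module.finrank K E := Module.card_eq_pow_finrank
  have hdvd := (hi.natDegree_dvd_iff_dvd_X_pow_card_pow_sub_X
    (n := Module.finrank K E)).1 hd
  rw [Nat.card_eq_fintype_card, ← hcard] at hdvd
  have hdvd' := Polynomial.map_dvd (algebraMap K E) hdvd
  have hne : (X ^ Fintype.card E - X : E[X]) ≠ 0 :=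
    FiniteField.X_pow_card_sub_X_ne_zero E Fintype.one_lt_card
  have hs : (X ^ Fintype.card E - X : E[X]).Splits := by
    have := IsSplittingField.splits E (X ^ Fintype.card E - X : E[X])
    simpa using this
  simp only [Polynomial.map_sub, Polynomial.map_pow, map_X] at hdvd'
  have hsp : (π.map (algebraMap K E)).Splits := hs.of_dvd hne hdvd'
  have hnd : (π.map (algebraMap K E)).roots.Nodup := by
    refine Multiset.nodup_of_le (Polynomial.roots.le_of_dvd hne hdvd') ?_
    rw [FiniteField.roots_X_pow_card_sub_X]
    exact Finset.univ.nodup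
  rw [← hm.natDegree_map (algebraMap K E), hsp.natDegree_eq_card_roots,
    ← Multiset.toFinset_card_of_nodup hnd]
  congr 1
  ext a
  simp only [Finset.mem_filter, Finset.mem_univ, true_and, Multiset.mem_toFinset]
  rw [mem_roots (hm.map _).ne_zero, IsRoot.def, eval_map_algebraMap]
  constructor
  · rintro rfl; exact minpoly.aeval _ _
  · intro h; exact (minpoly.eq_of_irreducible_of_monic hi h hm).symm

end FieldFacts

section Rec
variable {K : Type*} [Field K] [Fintype K]

lemma mon_finite (K : Type*) [Field K] [Fintype K] (k : ℕ) :
    {f : K[X] | f.Monic ∧ f.natDegree = k}.Finite := by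
  have : Finite (degreeLT K (k + 1)) :=
    Finite.of_equiv _ (degreeLTEquiv K (k + 1)).toEquiv.symm
  refine Set.Finite.subset (Set.toFinite (degreeLT K (k + 1) : Set K[X])) ?_
  rintro f ⟨h1, h2⟩
  rw [SetLike.mem_coe, mem_degreeLT, degree_eq_natDegree h1.ne_zero, h2]
  exact_mod_cast Nat.lt_succ_self k

noncomputable def Mon (K : Type*) [Field K] [Fintype K] (k : ℕ) : Finset K[X] :=
  (mon_finite K k).toFinset

lemma mem_Mon {k : ℕ} {f : K[X]} : f ∈ Mon K k ↔ f.Monic ∧ f.natDegree = k := by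
  simp [Mon]

open Classical in
noncomputable def Irr (K : Type*) [Field K] [Fintype K] (k : ℕ) : Finset K[X] :=
  (Mon K k).filter Irreducible

lemma mem_Irr {k : ℕ} {f : K[X]} : f ∈ Irr K k ↔ (f.Monic ∧ f.natDegree = k) ∧ Irreducible f := by
  simp [Irr, mem_Mon]

noncomputable def LA (l : K[X] →* ℂ) (k : ℕ) : ℂ := ∑ f ∈ Mon K k, l f

noncomputable def LS (l : K[X] →* ℂ) (j : ℕ) : ℂ :=
  ∑ x ∈ j.divisorsAntidiagonal, ∑ π ∈ Irr K x.1, (x.1 : ℂ) * l π ^ x.2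

lemma LA_zero (l : K[X] →* ℂ) : LA l 0 = 1 := by
  have : Mon K 0 = {1} := by
    ext f
    rw [mem_Mon, Finset.mem_singleton]
    constructor
    · rintro ⟨h1, h2⟩; exact h1.natDegree_eq_zero.1 h2
    · rintro rfl; simp
  simp [LA, this]

open Classical in
lemma deg_identity (k : ℕ) (f : K[X]) (hf : f ∈ Mon K k) :
    k = ∑ e ∈ Finset.Icc 1 k, ∑ π ∈ Irr K e, e * ((Finset.Icc 1 k).filter (fun t => π ^ t ∣ f)).card := by
  obtain ⟨hm, hk⟩ := mem_Mon.1 hf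
  have hf0 := hm.ne_zero
  set nf := UniqueFactorizationMonoid.normalizedFactors f with hnf
  have hmem : ∀ π, π ∈ nf ↔ Irreducible π ∧ π.Monic ∧ π ∣ f := fun π =>
    Polynomial.mem_normalizedFactors_iff hf0
  have hprod : nf.prod = f := by
    have := leadingCoeff_mul_prod_normalizedFactors f
    rwa [hm.leadingCoeff, C_1, one_mul] at this
  have hdeg : k = ∑ π ∈ nf.toFinset, nf.count π * π.natDegree := by
    rw [← hk]
    conv_lhs => rw [← hprod]
    rw [natDegree_multiset_prod_of_monic _ (fun g hg => ((hmem g).1 hg).2.1),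
      Finset.sum_multiset_map_count]
    simp
  have hcount : ∀ π, Irreducible π → π.Monic →
      ((Finset.Icc 1 k).filter (fun t => π ^ t ∣ f)).card = nf.count π := by
    intro π hi hpm
    have hdv : ∀ t, π ^ t ∣ f ↔ t ≤ nf.count π := by
      intro t
      rw [pow_dvd_iff_le_emultiplicity,
        UniqueFactorizationMonoid.emultiplicity_eq_count_normalizedFactors hi hf0,
        hpm.normalize_eq_self]
      exact_mod_cast Iff.rfl
    have hle : nf.count π ≤ k := by
      have := natDegree_le_of_dvd ((hdv _).2 le_rfl) hf0
      rw [natDegree_pow, hk] at this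
      have h1 := hi.natDegree_pos
      nlinarith
    have : (Finset.Icc 1 k).filter (fun t => π ^ t ∣ f) = Finset.Icc 1 (nf.count π) := by
      ext t
      simp only [Finset.mem_filter, Finset.mem_Icc, hdv]
      omega
    rw [this]; simp
  have hbi : nf.toFinset ⊆ (Finset.Icc 1 k).biUnion (Irr K) := by
    intro π hπ
    rw [Multiset.mem_toFinset, hmem] at hπ
    obtain ⟨hi, hpm, hdv⟩ := hπ
    rw [Finset.mem_biUnion]
    refine ⟨π.natDegree, Finset.mem_Icc.2 ⟨hi.natDegree_pos, ?_⟩, mem_Irr.2 ⟨⟨hpm, rfl⟩, hi⟩⟩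
    rw [← hk]; exact natDegree_le_of_dvd hdv hf0
  have hdisj : ((Finset.Icc 1 k : Finset ℕ) : Set ℕ).PairwiseDisjoint (Irr K) := by
    intro i _ j _ hij
    rw [Function.onFun, Finset.disjoint_left]
    intro g h1 h2
    exact hij ((mem_Irr.1 h1).1.2.symm.trans (mem_Irr.1 h2).1.2)
  refine hdeg.trans ?_
  rw [Finset.sum_subset hbi]
  · rw [Finset.sum_biUnion hdisj]
    refine Finset.sum_congr rfl fun e _ => Finset.sum_congr rfl fun π hπ => ?_
    obtain ⟨⟨h1, h2⟩, h3⟩ := mem_Irr.1 hπ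
    rw [hcount π h3 h1, h2, mul_comm]
  · intro π _ hπ
    rw [Multiset.mem_toFinset] at hπ
    simp [Multiset.count_eq_zero_of_notMem hπ]

open Classical in
lemma sum_dvd (l : K[X] →* ℂ) (k e t : ℕ) (π : K[X]) (hπ : π ∈ Irr K e) :
    ∑ f ∈ (Mon K k).filter (fun f => π ^ t ∣ f), l f =
      if e * t ≤ k then l π ^ t * LA l (k - e * t) else 0 := by
  obtain ⟨⟨h1, h2⟩, h3⟩ := mem_Irr.1 hπ
  have hmt : (π ^ t).Monic := h1.pow t
  have hdt : (π ^ t).natDegree = e * t := by rw [natDegree_pow, h2, mul_comm]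
  split_ifs with h
  · rw [LA, Finset.mul_sum]
    symm
    refine Finset.sum_bij (fun g _ => π ^ t * g) ?_ ?_ ?_ ?_
    · intro g hg
      obtain ⟨g1, g2⟩ := mem_Mon.1 hg
      rw [Finset.mem_filter, mem_Mon]
      refine ⟨⟨hmt.mul g1, ?_⟩, dvd_mul_right _ _⟩
      rw [hmt.natDegree_mul g1, hdt, g2]; omega
    · intro g _ g' _ hgg
      exact mul_left_cancel₀ hmt.ne_zero hgg
    · intro f hf
      rw [Finset.mem_filter, mem_Mon] at hf
      obtain ⟨⟨f1, f2⟩, g, rfl⟩ := hf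
      have hg : g.Monic := hmt.of_mul_monic_left f1
      refine ⟨g, mem_Mon.2 ⟨hg, ?_⟩, rfl⟩
      rw [hmt.natDegree_mul hg, hdt] at f2
      omega
    · intro g _
      rw [map_mul, map_pow]
  · apply Finset.sum_eq_zero
    intro f hf
    exfalso
    rw [Finset.mem_filter, mem_Mon] at hf
    have := natDegree_le_of_dvd hf.2 hf.1.1.ne_zero
    rw [hdt, hf.1.2] at this
    exact h this

lemma LA_rec (l : K[X] →* ℂ) (k : ℕ) :
    (k : ℂ) * LA l k = ∑ j ∈ Finset.Icc 1 k, LS l j * LA l (k - j) := by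
  classical
  have hL : (k : ℂ) * LA l k = ∑ e ∈ Finset.Icc 1 k, ∑ t ∈ Finset.Icc 1 k,
      if e * t ≤ k then (∑ π ∈ Irr K e, (e : ℂ) * l π ^ t) * LA l (k - e * t) else 0 := by
    calc (k : ℂ) * LA l k
        = ∑ f ∈ Mon K k, ∑ e ∈ Finset.Icc 1 k, ∑ π ∈ Irr K e, ∑ t ∈ Finset.Icc 1 k,
            if π ^ t ∣ f then (e : ℂ) * l f else 0 := by
          rw [LA, Finset.mul_sum]
          refine Finset.sum_congr rfl fun f hf => ?_
          have := deg_identity k f hf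
          have h2 : (k : ℂ) = ((∑ e ∈ Finset.Icc 1 k, ∑ π ∈ Irr K e,
            e * ((Finset.Icc 1 k).filter (fun t => π ^ t ∣ f)).card : ℕ) : ℂ) := by
              exact_mod_cast this
          rw [h2]
          push_cast
          rw [Finset.sum_mul]
          refine Finset.sum_congr rfl fun e _ => ?_
          rw [Finset.sum_mul]
          refine Finset.sum_congr rfl fun π _ => ?_
          rw [← Finset.sum_filter, Finset.sum_const, nsmul_eq_mul]
          ring
      _ = ∑ e ∈ Finset.Icc 1 k, ∑ t ∈ Finset.Icc 1 k, ∑ π ∈ Irr K e, ∑ f ∈ Mon K k,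
            if π ^ t ∣ f then (e : ℂ) * l f else 0 := by
          rw [Finset.sum_comm]
          refine Finset.sum_congr rfl fun e _ => ?_
          rw [Finset.sum_comm]
          rw [Finset.sum_comm (s := Finset.Icc 1 k)]
          refine Finset.sum_congr rfl fun π _ => ?_
          rw [Finset.sum_comm]
      _ = _ := by
          refine Finset.sum_congr rfl fun e _ => Finset.sum_congr rfl fun t _ => ?_
          have : ∀ π ∈ Irr K e, (∑ f ∈ Mon K k, if π ^ t ∣ f then (e : ℂ) * l f else 0) =
              if e * t ≤ k then (e : ℂ) * l π ^ t * LA l (k - e * t) else 0 := by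
            intro π hπ
            rw [← Finset.sum_filter, ← Finset.mul_sum, sum_dvd l k e t π hπ]
            split_ifs <;> ring
          rw [Finset.sum_congr rfl this]
          split_ifs
          · rw [Finset.sum_mul]
          · simp
  rw [hL, ← Finset.sum_product', ← Finset.sum_filter,
    ← Finset.sum_fiberwise_of_maps_to (t := Finset.Icc 1 k) (g := fun x : ℕ × ℕ => x.1 * x.2)]
  · refine Finset.sum_congr rfl fun j hj => ?_
    rw [Finset.mem_Icc] at hj
    rw [LS, Finset.sum_mul]
    refine Finset.sum_congr ?_ ?_
    · ext ⟨x, y⟩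
      simp only [Finset.mem_filter, Finset.mem_product, Finset.mem_Icc,
        Nat.mem_divisorsAntidiagonal]
      constructor
      · rintro ⟨_, h⟩
        exact ⟨h, by omega⟩
      · rintro ⟨h, h0⟩
        have hx : x ≠ 0 := by rintro rfl; simp at h; omega
        have hy : y ≠ 0 := by rintro rfl; simp at h; omega
        have : x ≤ x * y := Nat.le_mul_of_pos_right _ (by omega)
        have : y ≤ x * y := Nat.le_mul_of_pos_left _ (by omega)
        omega
    · intro x hx
      rw [Nat.mem_divisorsAntidiagonal] at hx
      rw [hx.1]
  · intro x hx
    simp only [Finset.mem_filter, Finset.mem_product, Finset.mem_Icc] at hx ⊢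
    exact ⟨Nat.mul_pos (by omega) (by omega), hx.2⟩

end Rec


lemma exists_recurrence {ι : Type*} [Fintype ι] (u : ι → ℂ) (hu : ∀ i, ‖u i‖ = 1) (T : ℕ) :
    ∃ t ≥ T, ∀ i, ‖u i ^ t - 1‖ < 1 / 2 := by
  have hmem : ∀ t : ℕ, (fun i => u i ^ t) ∈ Metric.closedBall (0 : ι → ℂ) 1 := by
    intro t
    rw [mem_closedBall_zero_iff, pi_norm_le_iff_of_nonneg zero_le_one]
    intro i
    simp [hu]
  obtain ⟨a, -, φ, hφ, hlim⟩ := (isCompact_closedBall (0 : ι → ℂ) 1).tendsto_subseq hmem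
  obtain ⟨M, hM⟩ := Metric.cauchySeq_iff.1 hlim.cauchySeq (1 / 2) (by norm_num)
  have hle : φ M + T ≤ φ (M + T) := by
    clear hM
    induction T with
    | zero => simp
    | succ T ih =>
      have : φ (M + T) < φ (M + (T + 1)) := hφ (by omega)
      omega
  refine ⟨φ (M + T) - φ M, by omega, fun i => ?_⟩
  have h1 := hM (M + T) (by omega) M le_rfl
  have h2 := lt_of_le_of_lt (dist_le_pi_dist _ _ i) h1
  simp only [Function.comp, dist_eq_norm] at h2
  have h3 : u i ^ φ (M + T) - u i ^ φ M = u i ^ φ M * (u i ^ (φ (M + T) - φ M) - 1) := by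
    rw [mul_sub, ← pow_add, mul_one]
    congr 2; omega
  rw [h3, norm_mul, norm_pow, hu, one_pow, one_mul] at h2
  exact h2

lemma norm_le_one_of_powersum {ι : Type*} [Fintype ι] (α : ι → ℂ) (B : ℝ)
    (h : ∀ t : ℕ, 1 ≤ t → ‖∑ i, α i ^ t‖ ≤ B) (i : ι) : ‖α i‖ ≤ 1 := by
  classical
  by_contra! hlt
  let u : ι → ℂ := fun i => if α i = 0 then 1 else α i / (‖α i‖ : ℂ)
  have hu : ∀ i, ‖u i‖ = 1 := by
    intro i
    by_cases h0 : α i = 0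
    · simp [u, h0]
    · simp [u, h0]
  obtain ⟨T, hT⟩ := pow_unbounded_of_one_lt (2 * B) hlt
  obtain ⟨t, ht, htu⟩ := exists_recurrence u hu (T + 1)
  have hre : ∀ j, ‖α j‖ ^ t / 2 ≤ (α j ^ t).re := by
    intro j
    by_cases h0 : α j = 0
    · have : t ≠ 0 := by omega
      simp [h0, this]
    · have e : α j = (‖α j‖ : ℂ) * u j := by
        simp only [u, h0, if_false]
        rw [mul_div_cancel₀]
        simpa using h0
      have e2 : (α j ^ t).re = ‖α j‖ ^ t * (u j ^ t).re := by
        conv_lhs => rw [e]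
        rw [mul_pow, ← Complex.ofReal_pow, Complex.re_ofReal_mul]
      have h1 := (Complex.abs_re_le_norm (u j ^ t - 1)).trans (htu j).le
      rw [abs_le] at h1
      simp only [Complex.sub_re, Complex.one_re] at h1
      rw [e2]
      have : 0 ≤ ‖α j‖ ^ t := by positivity
      nlinarith
  have h1 := (Complex.re_le_norm (∑ j, α j ^ t)).trans (h t (by omega))
  rw [Complex.re_sum] at h1
  have h2 : ‖α i‖ ^ t / 2 ≤ ∑ j, (α j ^ t).re := by
    refine (hre i).trans (Finset.single_le_sum (f := fun j => (α j ^ t).re) (fun j _ => ?_) (Finset.mem_univ i))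
    exact le_trans (by positivity) (hre j)
  have h3 : ‖α i‖ ^ T ≤ ‖α i‖ ^ t := pow_le_pow_right₀ hlt.le (by omega)
  linarith

lemma exists_omega (N : ℕ) (A : ℕ → ℂ) (h0 : A 0 = 1) (hN : ∀ k, N < k → A k = 0) :
    ∃ ω : Fin N → ℂ, ∀ k, MvPolynomial.aeval ω (MvPolynomial.esymm (Fin N) ℂ k) = (-1) ^ k * A k := by
  classical
  let M : ℂ[X] := ∑ k ∈ Finset.range (N + 1), C (A k) * X ^ (N - k)
  have hcoeff : ∀ j ≤ N, M.coeff j = A (N - j) := by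
    intro j hj
    simp only [M, finsetSum_coeff, coeff_C_mul, coeff_X_pow]
    rw [Finset.sum_eq_single (N - j)]
    · rw [if_pos (by omega), mul_one]
    · intro b hb hbj
      rw [Finset.mem_range] at hb
      rw [if_neg (by omega), mul_zero]
    · intro h; exfalso; apply h; rw [Finset.mem_range]; omega
  have hdeg : M.natDegree = N := by
    apply natDegree_eq_of_le_of_coeff_ne_zero
    · refine natDegree_sum_le_of_forall_le _ _ fun k _ => ?_
      exact (natDegree_C_mul_X_pow_le _ _).trans (Nat.sub_le _ _)
    · rw [hcoeff N le_rfl]; simp [h0]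
  have hlead : M.leadingCoeff = 1 := by
    rw [leadingCoeff, hdeg, hcoeff N le_rfl]; simp [h0]
  have hroots : M.roots.card = M.natDegree := (IsAlgClosed.splits M).natDegree_eq_card_roots.symm
  have hlen : M.roots.toList.length = N := by simp [hroots, hdeg]
  let ω : Fin N → ℂ := fun i => M.roots.toList.get (i.cast hlen.symm)
  have hω : Finset.univ.val.map ω = M.roots := by
    conv_rhs => rw [← Multiset.coe_toList M.roots]
    have : (Finset.univ : Finset (Fin N)).val = (List.finRange N : Multiset (Fin N)) := rfl
    rw [this, Multiset.map_coe]
    congr 1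
    apply List.ext_get
    · simp [hlen]
    · intro n h1 h2
      simp [ω]
  refine ⟨ω, fun k => ?_⟩
  rw [MvPolynomial.aeval_esymm_eq_multiset_esymm]
  rw [hω]
  by_cases hk : k ≤ N
  · have := coeff_eq_esymm_roots_of_card hroots (k := N - k) (by omega)
    rw [hcoeff _ (by omega), hlead, hdeg, show N - (N - k) = k by omega, one_mul] at this
    rw [this, ← mul_assoc, ← mul_pow]
    simp
  · rw [hN k (by omega), mul_zero, Multiset.esymm, Multiset.powersetCard_eq_empty _ (by omega)]
    simp

lemma newton_S (N : ℕ) (A S : ℕ → ℂ) (h0 : A 0 = 1) (hN : ∀ k, N < k → A k = 0)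
    (hrec : ∀ k : ℕ, (k : ℂ) * A k = ∑ j ∈ Finset.Icc 1 k, S j * A (k - j)) :
    ∃ ω : Fin N → ℂ, ∀ j, 1 ≤ j → S j = - ∑ i, ω i ^ j := by
  classical
  obtain ⟨ω, hω⟩ := exists_omega N A h0 hN
  refine ⟨ω, fun k => ?_⟩
  have hps : ∀ j, MvPolynomial.aeval ω (MvPolynomial.psum (Fin N) ℂ j) = ∑ i, ω i ^ j := by
    intro j; simp [MvPolynomial.psum]
  have hp : ∀ k : ℕ, (k : ℂ) * A k = - ∑ j ∈ Finset.Icc 1 k, (∑ i, ω i ^ j) * A (k - j) := by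
    intro k
    have h1 := congrArg (MvPolynomial.aeval ω) (MvPolynomial.mul_esymm_eq_sum (Fin N) ℂ k)
    simp only [map_mul, map_sum, map_pow, map_neg, map_one, map_natCast, hps, hω] at h1
    have hsq : ∀ n : ℕ, ((-1 : ℂ) ^ n) * (-1) ^ n = 1 := by
      intro n; rw [← mul_pow]; simp
    have h2 : ∑ x ∈ Finset.HasAntidiagonal.antidiagonal k with x.1 < k,
        (-1 : ℂ) ^ x.1 * ((-1) ^ x.1 * A x.1) * ∑ i, ω i ^ x.2 =
        ∑ j ∈ Finset.Icc 1 k, (∑ i, ω i ^ j) * A (k - j) := by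
      refine Finset.sum_bij (fun x _ => x.2) ?_ ?_ ?_ ?_
      · intro x hx
        simp only [Finset.mem_filter, Finset.HasAntidiagonal.mem_antidiagonal, Finset.mem_Icc] at hx ⊢
        omega
      · intro x hx y hy hxy
        simp only [Finset.mem_filter, Finset.HasAntidiagonal.mem_antidiagonal] at hx hy hxy
        ext <;> omega
      · intro j hj
        rw [Finset.mem_Icc] at hj
        refine ⟨(k - j, j), ?_, rfl⟩
        simp only [Finset.mem_filter, Finset.HasAntidiagonal.mem_antidiagonal]
        omega
      · intro x hx
        simp only [Finset.mem_filter, Finset.HasAntidiagonal.mem_antidiagonal] at hx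
        rw [← mul_assoc, hsq, one_mul, show k - x.2 = x.1 by omega, mul_comm]
    rw [h2] at h1
    have h3 := hsq k
    have h4 := congrArg (fun z => (-1 : ℂ) ^ k * z) h1
    simp only [pow_succ] at h4
    linear_combination h4 + (- ∑ j ∈ Finset.Icc 1 k, (∑ i, ω i ^ j) * A (k - j) - k * A k) * h3
  induction k using Nat.strong_induction_on with
  | _ k ih =>
    intro hk
    have h1 : ∑ j ∈ Finset.Icc 1 k, (S j + ∑ i, ω i ^ j) * A (k - j) = 0 := by
      simp only [add_mul, Finset.sum_add_distrib]
      linear_combination hp k - hrec k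
    rw [Finset.sum_eq_single k] at h1
    · simp only [Nat.sub_self, h0, mul_one] at h1
      linear_combination h1
    · intro j hj hjk
      rw [Finset.mem_Icc] at hj
      rw [ih j (by omega) hj.1]
      ring
    · intro h; exfalso; apply h; rw [Finset.mem_Icc]; omega

lemma weil_of_bound (N m : ℕ) (hm : 1 ≤ m) (q : ℕ) (hq : 1 ≤ q) (A S : ℕ → ℂ) (h0 : A 0 = 1)
    (hN : ∀ k, N < k → A k = 0)
    (hrec : ∀ k : ℕ, (k : ℂ) * A k = ∑ j ∈ Finset.Icc 1 k, S j * A (k - j)) (B : ℝ)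
    (hB : ∀ s : ℕ, 1 ≤ s → ‖S (m * (2 * s))‖ ≤ B * (q : ℝ) ^ (m * s)) :
    ‖A 1‖ ≤ N * Real.sqrt q := by
  obtain ⟨ω, hω⟩ := newton_S N A S h0 hN hrec
  have hqR : (0 : ℝ) < q := by exact_mod_cast hq
  have hle : ∀ i, ‖ω i‖ ≤ Real.sqrt q := by
    intro i
    have := norm_le_one_of_powersum (fun i => ω i ^ (2 * m) / (q : ℂ) ^ m) B (by
      intro t ht
      have h1 := hB t ht
      rw [hω _ (by nlinarith), norm_neg] at h1
      have : ∑ i, (ω i ^ (2 * m) / (q : ℂ) ^ m) ^ t = (∑ i, ω i ^ (m * (2 * t))) / (q : ℂ) ^ (m * t) := by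
        rw [Finset.sum_div]
        refine Finset.sum_congr rfl fun i _ => ?_
        rw [div_pow, ← pow_mul, ← pow_mul]
        congr 2; ring
      rw [this, norm_div, norm_pow, Complex.norm_natCast, div_le_iff₀ (by positivity)]
      exact h1) i
    simp only [norm_div, norm_pow, Complex.norm_natCast] at this
    rw [div_le_one (by positivity), pow_mul] at this
    apply Real.le_sqrt_of_sq_le
    exact le_of_pow_le_pow_left₀ (by omega) hqR.le this
  have h1 : A 1 = S 1 := by
    have := hrec 1
    simpa [h0] using this
  rw [h1, hω 1 le_rfl, norm_neg]
  refine (norm_sum_le _ _).trans ?_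
  refine (Finset.sum_le_sum (g := fun _ => Real.sqrt q) fun i _ => ?_).trans (by simp)
  simpa using hle i

section Katz
variable {K F : Type*} [Field K] [Fintype K] [Field F] [Fintype F] [Algebra K F]

noncomputable def lam (K : Type*) {F : Type*} [Field K] [Field F] [Algebra K F] (v : F)
    (χ : MulChar F ℂ) : K[X] →* ℂ :=
  χ.toMonoidHom.comp ((aeval v : K[X] →ₐ[K] F) : K[X] →* F)

lemma lam_apply (v : F) (χ : MulChar F ℂ) (f : K[X]) : lam K v χ f = χ (aeval v f) := rfl

lemma LA_lam_zero (v : F) (χ : MulChar F ℂ) (hχ : χ ≠ 1)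
    (hv : (minpoly K v).natDegree = Module.finrank K F) (k : ℕ) (hk : Module.finrank K F ≤ k) :
    LA (lam K v χ) k = 0 := by
  have hIntg : IsIntegral K v := IsIntegral.of_finite K v
  have hsurj : ∀ y : F, ∃ g : K[X], aeval v g = y ∧ g.degree < k := by
    intro y
    have htop : IntermediateField.adjoin K {v} = ⊤ :=
      (Field.primitive_element_iff_minpoly_natDegree_eq K v).2 hv
    have : y ∈ (⊤ : IntermediateField K F) := trivial
    rw [← htop, ← IntermediateField.mem_toSubalgebra,
      IntermediateField.adjoin_simple_toSubalgebra_of_isAlgebraic hIntg.isAlgebraic,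
      Algebra.adjoin_singleton_eq_range_aeval] at this
    obtain ⟨g, hg⟩ := this
    refine ⟨g %ₘ minpoly K v, ?_, ?_⟩
    · have hg' : aeval v g = y := hg
      rw [aeval_modByMonic_eq_self_of_root (minpoly.aeval K v), hg']
    · refine (degree_modByMonic_lt _ (minpoly.monic hIntg)).trans_le ?_
      rw [degree_eq_natDegree (minpoly.ne_zero hIntg), hv]
      exact_mod_cast hk
  have hshift : ∀ y : F, LA (lam K v χ) k = ∑ f ∈ Mon K k, χ (aeval v f + y) := by
    intro y
    obtain ⟨g, hg, hgd⟩ := hsurj y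
    have hmem : ∀ f ∈ Mon K k, ∀ h : K[X], h.degree < k → f + h ∈ Mon K k := by
      intro f hf h hh
      obtain ⟨h1, h2⟩ := mem_Mon.1 hf
      have hlt : h.degree < f.degree := by
        rw [degree_eq_natDegree h1.ne_zero, h2]; exact hh
      refine mem_Mon.2 ⟨h1.add_of_left hlt, ?_⟩
      rw [natDegree_add_eq_left_of_degree_lt hlt, h2]
    symm
    refine Finset.sum_bij (fun f _ => f + g) ?_ ?_ ?_ ?_
    · intro f hf; exact hmem f hf g hgd
    · intro f _ f' _ h; exact add_right_cancel h
    · intro f hf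
      exact ⟨f + -g, hmem f hf (-g) (by rwa [degree_neg]), by ring⟩
    · intro f _
      rw [lam_apply, map_add (aeval v), hg]
  have hsum : (Fintype.card F : ℂ) * LA (lam K v χ) k = 0 := by
    have : ∑ y : F, LA (lam K v χ) k = 0 := by
      rw [Finset.sum_congr rfl fun y _ => hshift y, Finset.sum_comm]
      refine Finset.sum_eq_zero fun f _ => ?_
      rw [← MulChar.sum_eq_zero_of_ne_one hχ]
      exact Equiv.sum_comp (Equiv.addLeft (aeval v f)) (fun z => χ z)
    simpa using this
  rcases mul_eq_zero.1 hsum with h | h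
  · exact absurd h (by exact_mod_cast Fintype.card_ne_zero)
  · exact h

lemma LS_eq {E : Type*} [Field E] [Fintype E] [Algebra K E] (l : K[X] →* ℂ) :
    LS l (Module.finrank K E) =
      ∑ a : E, l (minpoly K a ^ (Module.finrank K E / (minpoly K a).natDegree)) := by
  classical
  have hr : Module.finrank K E ≠ 0 := Module.finrank_pos.ne'
  set r := Module.finrank K E with hrdef
  rw [LS, Finset.sum_sigma']
  rw [← Finset.sum_fiberwise_of_maps_to
    (t := r.divisorsAntidiagonal.sigma (fun x => Irr K x.1))
    (g := fun a : E => (⟨((minpoly K a).natDegree, r / (minpoly K a).natDegree), minpoly K a⟩ :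
      (_ : ℕ × ℕ) × K[X]))]
  · refine Finset.sum_congr rfl ?_
    rintro ⟨⟨e, t⟩, π⟩ hx
    simp only [Finset.mem_sigma, Nat.mem_divisorsAntidiagonal, mem_Irr] at hx
    obtain ⟨⟨het, -⟩, ⟨hm, hd⟩, hi⟩ := hx
    subst hd
    have hpos := hi.natDegree_pos
    have ht : r / π.natDegree = t := by rw [← het, Nat.mul_div_cancel_left _ hpos]
    have hfil : (Finset.univ.filter (fun a : E =>
        (⟨((minpoly K a).natDegree, r / (minpoly K a).natDegree), minpoly K a⟩ :
        (_ : ℕ × ℕ) × K[X]) = ⟨(π.natDegree, t), π⟩)) =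
        Finset.univ.filter (fun a : E => minpoly K a = π) := by
      ext a
      simp only [Finset.mem_filter, Finset.mem_univ, true_and]
      constructor
      · intro h
        simp only [Sigma.mk.injEq, heq_eq_eq] at h
        exact h.2
      · rintro rfl
        rw [ht]
    rw [hfil, Finset.sum_congr rfl (g := fun _ => l π ^ t)]
    · rw [Finset.sum_const, card_minpoly_eq π hm hi ⟨t, het.symm⟩, nsmul_eq_mul]
    · intro a ha
      rw [Finset.mem_filter] at ha
      rw [ha.2, ht, map_pow]
  · intro a _
    have hIntg : IsIntegral K a := IsIntegral.of_finite K a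
    simp only [Finset.mem_sigma, Nat.mem_divisorsAntidiagonal, mem_Irr]
    exact ⟨⟨Nat.mul_div_cancel' (minpoly.degree_dvd hIntg), hr⟩,
      ⟨minpoly.monic hIntg, trivial⟩, minpoly.irreducible hIntg⟩

end Katz

section Katz2
variable {K F E : Type*} [Field K] [Fintype K] [Field F] [Fintype F] [Algebra K F]
  [Field E] [Fintype E] [Algebra F E] [Algebra K E] [IsScalarTower K F E]

lemma add_pow_card_pow' (K : Type*) {E : Type*} [Field K] [Fintype K] [Field E] [Algebra K E]
    (x y : E) (j : ℕ) :
    (x + y) ^ (Fintype.card K ^ j) = x ^ (Fintype.card K ^ j) + y ^ (Fintype.card K ^ j) := by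
  induction j with
  | zero => simp
  | succ j ih =>
    simp only [pow_succ, pow_mul]
    rw [ih]
    exact map_add (FiniteField.frobeniusAlgHom K E) _ _

noncomputable def wfun (K : Type*) {E : Type*} [Fintype K] [Field E] (m : ℕ) (v a : E) : E :=
  ∏ j ∈ Finset.range m, (v - a ^ (Fintype.card K ^ j))

noncomputable def ftil (K : Type*) {F : Type*} [Fintype K] [Field F] (m : ℕ) (v : F) : F[X] :=
  -∏ j ∈ Finset.range (m - 1),
    (C (v - v ^ (Fintype.card K ^ (j + 1))) * X ^ (Fintype.card K ^ (j + 1)) - 1)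

lemma prod_eq_wfun (m t : ℕ) (hF : Fintype.card F = Fintype.card K ^ m) (v : F) (a : E) :
    ∏ i ∈ Finset.range (m * t), (algebraMap F E v - a ^ (Fintype.card K ^ i)) =
      wfun K m (algebraMap F E v) a ^ (∑ l ∈ Finset.range t, Fintype.card F ^ l) := by
  induction t with
  | zero => simp
  | succ t ih =>
    rw [mul_add, mul_one, Finset.prod_range_add, ih, Finset.sum_range_succ, pow_add]
    congr 1
    rw [wfun, ← Finset.prod_pow]
    refine Finset.prod_congr rfl fun j _ => ?_
    have := aeval_frob (K := F) (E := E) (C v - X) (a ^ (Fintype.card K ^ j)) t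
    simp only [map_sub, aeval_C, aeval_X] at this
    rw [← this, ← pow_mul, hF, ← pow_mul, ← pow_add]
    congr 3
    ring

lemma wfun_mobius (m : ℕ) (hm : 1 ≤ m) (v : F) (b : E) (hb : b ≠ 0) :
    wfun K m (algebraMap F E v) (algebraMap F E v + b⁻¹) *
      b ^ (∑ j ∈ Finset.range m, Fintype.card K ^ j) = aeval b (ftil K m v) := by
  obtain ⟨m, rfl⟩ : ∃ k, m = k + 1 := ⟨m - 1, by omega⟩
  rw [wfun, ← Finset.prod_pow_eq_pow_sum, ← Finset.prod_mul_distrib, Finset.prod_range_succ', ftil,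
    Nat.add_sub_cancel, map_neg, map_prod]
  have h0 : (algebraMap F E v - (algebraMap F E v + b⁻¹) ^ Fintype.card K ^ 0) *
      b ^ Fintype.card K ^ 0 = -1 := by
    rw [pow_zero, pow_one, pow_one]; field_simp; ring
  rw [h0, mul_neg_one]
  congr 1
  refine Finset.prod_congr rfl fun j _ => ?_
  rw [add_pow_card_pow' K]
  simp only [map_sub, map_mul, map_pow, aeval_C, aeval_X, map_one]
  rw [inv_pow]
  have : b ^ (Fintype.card K ^ (j + 1)) ≠ 0 := pow_ne_zero _ hb
  field_simp
  ring

lemma natDegree_ftil (m : ℕ) (v : F) (hv : (minpoly K v).natDegree = m) :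
    (ftil K m v).natDegree + 1 = ∑ j ∈ Finset.range m, Fintype.card K ^ j := by
  have hm : 0 < m := by rw [← hv]; exact minpoly.natDegree_pos (IsIntegral.of_finite K v)
  obtain ⟨m, rfl⟩ : ∃ k, m = k + 1 := ⟨m - 1, by omega⟩
  have hd : ∀ j ∈ Finset.range m, (C (v - v ^ (Fintype.card K ^ (j + 1))) *
      X ^ (Fintype.card K ^ (j + 1)) - 1 : F[X]).natDegree = Fintype.card K ^ (j + 1) := by
    intro j hj
    rw [Finset.mem_range] at hj
    have hne : v - v ^ (Fintype.card K ^ (j + 1)) ≠ 0 := by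
      intro h
      have := Nat.le_of_dvd (by omega) (frob_dvd v (j + 1) (sub_eq_zero.1 h).symm)
      omega
    rw [← C_1, natDegree_sub_C, natDegree_C_mul_X_pow _ _ hne]
  rw [ftil, Nat.add_sub_cancel, natDegree_neg, natDegree_prod, Finset.sum_congr rfl hd,
    Finset.sum_range_succ', pow_zero]
  intro j hj h0
  have := hd j hj
  rw [h0, natDegree_zero] at this
  exact (pow_ne_zero _ Fintype.card_ne_zero) this.symm

lemma char_fiber [DecidableEq F] (χ : MulChar F ℂ) (hχK : ∀ a : K, a ≠ 0 → χ (algebraMap K F a) = 1) (x : F)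
    (hx : x ≠ 0) :
    (Finset.univ.filter (fun y : F => x ^ (Fintype.card K - 1) = y ^ (Fintype.card K - 1))).card =
      Fintype.card K - 1 ∧
    ∀ y : F, x ^ (Fintype.card K - 1) = y ^ (Fintype.card K - 1) → χ y = χ x := by
  classical
  have hK : 1 < Fintype.card K := Fintype.one_lt_card
  have key : ∀ y : F, x ^ (Fintype.card K - 1) = y ^ (Fintype.card K - 1) ↔
      ∃ a : K, a ≠ 0 ∧ y = algebraMap K F a * x := by
    intro y
    constructor
    · intro h
      have hy : y ≠ 0 := by
        rintro rfl
        rw [zero_pow (by omega)] at h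
        exact pow_ne_zero _ hx h
      have h1 : (y / x) ^ (Fintype.card K ^ 1) = y / x := by
        rw [pow_one]
        conv_lhs => rw [show Fintype.card K = (Fintype.card K - 1) + 1 by omega]
        rw [pow_succ, div_pow, ← h, div_self (pow_ne_zero _ hx), one_mul]
      have h2 := frob_dvd (K := K) (y / x) 1 h1
      have h3 := minpoly.natDegree_eq_one_iff.1 (Nat.dvd_one.1 h2)
      obtain ⟨a, ha⟩ := h3
      refine ⟨a, ?_, ?_⟩
      · rintro rfl
        rw [map_zero] at ha
        exact (div_ne_zero hy hx) ha.symm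
      · rw [ha, div_mul_cancel₀ _ hx]
    · rintro ⟨a, ha, rfl⟩
      rw [mul_pow, ← map_pow, FiniteField.pow_card_sub_one_eq_one a ha, map_one, one_mul]
  refine ⟨?_, ?_⟩
  · have : Finset.univ.filter (fun y : F => x ^ (Fintype.card K - 1) = y ^ (Fintype.card K - 1)) =
        (Finset.univ.erase (0 : K)).image (fun a => algebraMap K F a * x) := by
      ext y
      simp only [Finset.mem_filter, Finset.mem_univ, true_and, Finset.mem_image, Finset.mem_erase,
        and_true, key]
      exact ⟨fun ⟨a, h, h'⟩ => ⟨a, h, h'.symm⟩, fun ⟨a, h, h'⟩ => ⟨a, h, h'.symm⟩⟩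
    rw [this, Finset.card_image_of_injective]
    · simp
    · intro a b hab
      exact (algebraMap K F).injective (mul_right_cancel₀ hx hab)
  · intro y hy
    obtain ⟨a, ha, rfl⟩ := (key y).1 hy
    rw [map_mul, hχK a ha, one_mul]

end Katz2

section Katz3

lemma geom_mul (k u T : ℕ) (hu : u = T * k + 1) (s : ℕ) :
    u ^ s = T * (k * ∑ l ∈ Finset.range s, u ^ l) + 1 := by
  induction s with
  | zero => simp
  | succ s ih =>
    rw [Finset.sum_range_succ, pow_succ]
    conv_lhs => rw [hu, ← hu]
    calc u ^ s * u = u ^ s * (T * k + 1) := by rw [← hu]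
      _ = T * k * u ^ s + u ^ s := by ring
      _ = T * k * u ^ s + (T * (k * ∑ l ∈ Finset.range s, u ^ l) + 1) := by rw [← ih]
      _ = _ := by ring

variable {K F E : Type*} [Field K] [Fintype K] [Field F] [Fintype F] [Algebra K F]
  [Field E] [Fintype E] [Algebra F E] [Algebra K E] [IsScalarTower K F E]

noncomputable def Yfun (K : Type*) {F E : Type*} [Field K] [Field F] [Algebra K F]
    [Field E] [Algebra K E] (v : F) (a : E) : F :=
  aeval v (minpoly K a ^ (Module.finrank K E / (minpoly K a).natDegree))

lemma Yfun_eq (v : F) (a : E) (m t : ℕ) (hm : Module.finrank K F = m) (ht : Module.finrank F E = t) :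
    algebraMap F E (Yfun K v a) =
      wfun K m (algebraMap F E v) a ^ (∑ l ∈ Finset.range t, Fintype.card F ^ l) := by
  rw [Yfun, map_pow, map_pow, ← aeval_algebraMap_apply, aeval_minpoly_pow]
  have : Module.finrank K E = m * t := by rw [← hm, ← ht, Module.finrank_mul_finrank]
  rw [this, prod_eq_wfun]
  rw [← hm]; exact Module.card_eq_pow_finrank

set_option maxHeartbeats 1000000 in
lemma Yfun_count [DecidableEq F] (v : F) (m s : ℕ) (hm : Module.finrank K F = m) (hm2 : 2 ≤ m)
    (hv : (minpoly K v).natDegree = m)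
    (hs : Module.finrank F E = 2 * s) (hs1 : 1 ≤ s) :
    ∃ T M : ℕ, T = ∑ j ∈ Finset.range m, Fintype.card K ^ j ∧
      T * (Fintype.card K - 1) + 1 = Fintype.card F ∧
      T * M ≤ Fintype.card E + T * (T + 3) * Fintype.card F ^ (s + 1) ∧
      ∀ y : F, y ≠ 0 → (Finset.univ.filter (fun a : E => Yfun K v a ^ (Fintype.card K - 1) =
        y ^ (Fintype.card K - 1))).card ≤ M := by
  classical
  have hK : 1 < Fintype.card K := Fintype.one_lt_card
  obtain ⟨k, hk⟩ : ∃ k, Fintype.card K = k + 1 := ⟨Fintype.card K - 1, by omega⟩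
  have hk1 : 1 ≤ k := by omega
  set T := ∑ j ∈ Finset.range m, Fintype.card K ^ j with hT
  have hcF : Fintype.card F = Fintype.card K ^ m := by rw [← hm]; exact Module.card_eq_pow_finrank
  have hcE : Fintype.card E = Fintype.card F ^ (2 * s) := by
    rw [← hs]; exact Module.card_eq_pow_finrank
  have hu : Fintype.card F = T * k + 1 := by
    rw [hcF, geom_mul k (Fintype.card K) 1 (by omega) m, ← hT]; ring
  have hT3 : 3 ≤ T := by
    have : ∑ j ∈ Finset.range 2, Fintype.card K ^ j ≤ T :=
      Finset.sum_le_sum_of_subset (Finset.range_mono hm2)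
    simp [Finset.sum_range_succ] at this
    omega
  set u := Fintype.card F with hudef
  have hTu : T + 1 ≤ u := by rw [hu]; nlinarith
  set c := k * ∑ l ∈ Finset.range (s - 1), u ^ l with hc
  have hP : u ^ (s - 1) = T * c + 1 := geom_mul k u T hu (s - 1)
  set c' := u ^ 2 * c + k * (u + 1) with hc'
  have hP' : u ^ (s + 1) = T * c' + 1 := by
    have : s + 1 = (s - 1) + 2 := by omega
    rw [this, pow_add, hP, hc']
    have : T * k * (u + 1) + 1 = u ^ 2 := by
      have : u ^ 2 = (T * k + 1) * u := by rw [← hu]; ring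
      rw [this]; nlinarith
    nlinarith
  have hcard : Fintype.card E = u ^ (s - 1) * u ^ (s + 1) := by
    rw [hcE, ← pow_add]; congr 1; omega
  have hW : k * ∑ l ∈ Finset.range (2 * s), u ^ l = u ^ (s - 1) * c' + c := by
    have h1 := geom_mul k u T hu (2 * s)
    rw [← hcE, hcard] at h1
    have h2 : T * (k * ∑ l ∈ Finset.range (2 * s), u ^ l) = T * (u ^ (s - 1) * c' + c) := by
      have h3 : u ^ (s - 1) * u ^ (s + 1) = u ^ (s - 1) * (T * c' + 1) := by rw [hP']
      have h4 : u ^ (s - 1) * (T * c' + 1) = T * (u ^ (s - 1) * c') + u ^ (s - 1) := by ring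
      have h5 : T * (u ^ (s - 1) * c' + c) = T * (u ^ (s - 1) * c') + T * c := by ring
      omega
    exact Nat.eq_of_mul_eq_mul_left (by omega) h2
  have hTW : T * (u ^ (s - 1) * c' + c) + 1 = Fintype.card E := by
    rw [← hW, hcE]; exact (geom_mul k u T hu (2 * s)).symm
  have hdeg := natDegree_ftil (K := K) m v hv
  rw [← hT] at hdeg
  have hst := stepanov (E := E) (u ^ (s - 1)) (u ^ (s + 1)) T (T - 1) c c' (by omega) hP hP' hcard
    ((ftil K m v).map (algebraMap F E)) (by rw [natDegree_map]; omega) (by omega)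
    (by
      rw [Nat.coprime_self_sub_right (by omega)]; simp)
    (by
      intro a
      have := aeval_frob (K := F) (E := E) (ftil K m v) a (s - 1)
      rw [eval_map_algebraMap, eval_map_algebraMap]; exact this)
    (pow_card_pow_inj (K := F) (E := E) (s - 1))
    (by
      rw [hP, hc']
      have h1 : (T + 1) * c ≤ u ^ 2 * c :=
        Nat.mul_le_mul_right _ (hTu.trans (Nat.le_self_pow (by norm_num) u))
      have h2 : (T + 1) * c = T * c + c := by ring
      have h3 : 1 * (u + 1) ≤ k * (u + 1) := Nat.mul_le_mul_right _ hk1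
      omega)
  refine ⟨T, c * u ^ (s + 1) + (T - 1 + 4) * u ^ (s + 1), rfl, by rw [hu, hk]; simp, ?_, ?_⟩
  · rw [hcard, hP, show T - 1 + 4 = T + 3 by omega]
    have : T * (c * u ^ (s + 1) + (T + 3) * u ^ (s + 1)) + u ^ (s + 1) =
      (T * c + 1) * u ^ (s + 1) + T * (T + 3) * u ^ (s + 1) := by ring
    omega
  · intro y hy
    refine le_trans ?_ (hst (algebraMap F E y ^ k) (pow_ne_zero _ (by simpa using hy)))
    have key : ∀ a : E, Yfun K v a ^ (Fintype.card K - 1) = y ^ (Fintype.card K - 1) →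
        a - algebraMap F E v ≠ 0 ∧
        eval (a - algebraMap F E v)⁻¹ ((ftil K m v).map (algebraMap F E)) ^ (u ^ (s - 1) * c' + c) =
          algebraMap F E y ^ k := by
      intro a ha
      rw [hk, Nat.add_sub_cancel] at ha
      have hY := Yfun_eq (K := K) v a m (2 * s) hm hs
      have hY' : wfun K m (algebraMap F E v) a ^ (u ^ (s - 1) * c' + c) = algebraMap F E y ^ k := by
        rw [← hW, mul_comm k, pow_mul, ← hY, ← map_pow, ha, map_pow]
      have hne : a - algebraMap F E v ≠ 0 := by
        intro h0
        have hw : wfun K m (algebraMap F E v) a = 0 := by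
          rw [wfun]
          refine Finset.prod_eq_zero (i := 0) (by simp; omega) ?_
          rw [sub_eq_zero.1 h0]; simp
        rw [hw, zero_pow] at hY'
        · exact (pow_ne_zero k (by simpa using hy : algebraMap F E y ≠ 0)) hY'.symm
        · rw [← hW]
          intro h0
          have := geom_mul k u T hu (2 * s)
          rw [h0] at this
          rw [← hcE] at this
          have := Fintype.one_lt_card (α := E)
          omega
      refine ⟨hne, ?_⟩
      rw [eval_map_algebraMap, ← wfun_mobius (K := K) m (by omega) v _ (inv_ne_zero hne), inv_inv,
        add_sub_cancel, mul_pow, hY', ← pow_mul, ← hT]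
      have : T * (u ^ (s - 1) * c' + c) = Fintype.card E - 1 := by omega
      rw [this, FiniteField.pow_card_sub_one_eq_one _ (inv_ne_zero hne), mul_one]
    refine Finset.card_le_card_of_injOn (fun a => (a - algebraMap F E v)⁻¹) ?_ ?_
    · intro a ha
      simp only [Finset.coe_filter, Finset.mem_univ, true_and, Set.mem_ofPred_eq] at ha ⊢
      exact (key a ha).2
    · intro a _ b _ hab
      simpa using hab

end Katz3

section Katz4
variable {K F E : Type*} [Field K] [Fintype K] [Field F] [Fintype F] [Algebra K F]
  [Field E] [Fintype E] [Algebra F E] [Algebra K E] [IsScalarTower K F E]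

lemma mulChar_norm_le (χ : MulChar F ℂ) (y : F) : ‖χ y‖ ≤ 1 := by
  by_cases hy : y = 0
  · simp [hy, MulChar.map_zero]
  · refine (Complex.norm_eq_one_of_pow_eq_one (n := Fintype.card F - 1) ?_ ?_).le
    · rw [← map_pow, FiniteField.pow_card_sub_one_eq_one y hy, map_one]
    · have := Fintype.one_lt_card (α := F); omega

lemma Yfun_zero_card [DecidableEq F] (v : F) (m : ℕ) (hm : Module.finrank K F = m)
    (hv : (minpoly K v).natDegree = m) :
    (Finset.univ.filter (fun a : E => Yfun K v a = 0)).card ≤ m := by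
  classical
  have hIntg := IsIntegral.of_finite K v
  have := card_minpoly_eq (E := E) (minpoly K v) (minpoly.monic hIntg) (minpoly.irreducible hIntg)
    (by rw [hv, ← hm]; exact ⟨Module.finrank F E, (Module.finrank_mul_finrank K F E).symm⟩)
  rw [hv] at this
  rw [← this]
  refine Finset.card_le_card fun a ha => ?_
  simp only [Finset.mem_filter, Finset.mem_univ, true_and] at ha ⊢
  rw [Yfun, map_pow] at ha
  have h1 : aeval v (minpoly K a) = 0 := by
    by_contra h; exact pow_ne_zero _ h ha
  have hia := IsIntegral.of_finite K a
  exact minpoly.eq_of_irreducible_of_monic (minpoly.irreducible hia) h1 (minpoly.monic hia)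

lemma char_sum_bound [DecidableEq F] (χ : MulChar F ℂ) (hχ : χ ≠ 1)
    (hχK : ∀ a : K, a ≠ 0 → χ (algebraMap K F a) = 1) (Y : E → F) (T M m : ℕ)
    (hT : T * (Fintype.card K - 1) + 1 = Fintype.card F)
    (hM : ∀ y : F, y ≠ 0 → (Finset.univ.filter (fun a : E => Y a ^ (Fintype.card K - 1) =
        y ^ (Fintype.card K - 1))).card ≤ M)
    (hz : (Finset.univ.filter (fun a : E => Y a = 0)).card ≤ m) :
    ‖∑ a : E, χ (Y a)‖ ≤ (T : ℝ) * M - Fintype.card E + m := by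
  classical
  have hK : 1 < Fintype.card K := Fintype.one_lt_card
  set k := Fintype.card K - 1 with hk
  have hk1 : 1 ≤ k := by omega
  set n : F → ℕ := fun y => (Finset.univ.filter (fun a : E => Y a ^ k = y ^ k)).card with hn
  have hzero : ∀ y : F, (0 : F) ^ k = y ^ k ↔ y = 0 := by
    intro y
    rw [zero_pow (by omega), eq_comm, pow_eq_zero_iff (by omega)]
  have h1 : (k : ℂ) * ∑ a : E, χ (Y a) = ∑ y : F, χ y * n y := by
    have : ∀ y : F, χ y * n y = ∑ a : E, if Y a ^ k = y ^ k then χ y else 0 := by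
      intro y
      rw [← Finset.sum_filter, Finset.sum_const, nsmul_eq_mul, mul_comm]
    simp_rw [this]
    rw [Finset.sum_comm, Finset.mul_sum]
    refine Finset.sum_congr rfl fun a _ => ?_
    by_cases h : Y a = 0
    · rw [h]
      simp_rw [hzero]
      simp [MulChar.map_zero]
    · obtain ⟨hc, hv⟩ := char_fiber (K := K) χ hχK (Y a) h
      rw [← Finset.sum_filter, Finset.sum_congr rfl (g := fun _ => χ (Y a))
        (fun y hy => hv y (Finset.mem_filter.1 hy).2), Finset.sum_const, hc, nsmul_eq_mul]
  have h2 : ∑ y ∈ Finset.univ.erase (0 : F), (n y : ℝ) =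
      k * ((Fintype.card E : ℝ) - (Finset.univ.filter (fun a : E => Y a = 0)).card) := by
    have : ∀ y : F, (n y : ℝ) = ∑ a : E, if Y a ^ k = y ^ k then (1 : ℝ) else 0 := by
      intro y
      rw [← Finset.sum_filter, Finset.sum_const, nsmul_eq_mul, mul_one]
    simp_rw [this]
    rw [Finset.sum_comm]
    have h3 : ∀ a : E, (∑ y ∈ Finset.univ.erase (0 : F), if Y a ^ k = y ^ k then (1 : ℝ) else 0) =
        k * (1 - if Y a = 0 then (1 : ℝ) else 0) := by
      intro a
      by_cases h : Y a = 0
      · rw [if_pos h, sub_self, mul_zero]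
        refine Finset.sum_eq_zero fun y hy => ?_
        rw [h, if_neg]
        rw [hzero]
        exact Finset.ne_of_mem_erase hy
      · obtain ⟨hc, hv⟩ := char_fiber (K := K) χ hχK (Y a) h
        rw [if_neg h, sub_zero, mul_one, Finset.sum_erase, ← Finset.sum_filter, Finset.sum_const,
          hc, nsmul_eq_mul, mul_one]
        rw [if_neg]
        rw [zero_pow (by omega)]
        exact pow_ne_zero _ h
    rw [Finset.sum_congr rfl fun a _ => h3 a, ← Finset.mul_sum, Finset.sum_sub_distrib,
      Finset.sum_boole]
    simp
  have h3 : (k : ℂ) * ∑ a : E, χ (Y a) = ∑ y ∈ Finset.univ.erase (0 : F), χ y * ((n y : ℂ) - M) := by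
    rw [Finset.sum_erase _ (by simp [MulChar.map_zero])]
    simp_rw [mul_sub]
    rw [Finset.sum_sub_distrib, ← Finset.sum_mul, MulChar.sum_eq_zero_of_ne_one hχ, zero_mul,
      sub_zero, h1]
  have h4 : (k : ℝ) * ‖∑ a : E, χ (Y a)‖ ≤ ∑ y ∈ Finset.univ.erase (0 : F), ((M : ℝ) - n y) := by
    have : (k : ℝ) * ‖∑ a : E, χ (Y a)‖ = ‖(k : ℂ) * ∑ a : E, χ (Y a)‖ := by
      rw [norm_mul, Complex.norm_natCast]
    rw [this, h3]
    refine (norm_sum_le _ _).trans (Finset.sum_le_sum fun y hy => ?_)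
    rw [norm_mul]
    have hle : (n y : ℝ) ≤ M := by exact_mod_cast hM y (Finset.ne_of_mem_erase hy)
    have h5 : ‖(n y : ℂ) - M‖ = (M : ℝ) - n y := by
      have : (n y : ℂ) - M = (((n y : ℝ) - M : ℝ) : ℂ) := by push_cast; rfl
      rw [this, Complex.norm_real, Real.norm_eq_abs, abs_of_nonpos (by linarith)]
      ring
    rw [h5]
    exact mul_le_of_le_one_left (by linarith) (mulChar_norm_le χ y)
  rw [Finset.sum_sub_distrib, h2, Finset.sum_const, Finset.card_erase_of_mem (Finset.mem_univ _),
    Finset.card_univ, ← hT, Nat.add_sub_cancel, nsmul_eq_mul] at h4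
  have hkR : (1 : ℝ) ≤ k := by exact_mod_cast hk1
  have hzR : ((Finset.univ.filter (fun a : E => Y a = 0)).card : ℝ) ≤ m := by exact_mod_cast hz
  push_cast at h4
  refine le_of_mul_le_mul_left (h4.trans ?_) (by linarith : (0 : ℝ) < k)
  nlinarith

lemma LS_bound (v : F) (m s : ℕ) (hm : Module.finrank K F = m) (hm2 : 2 ≤ m)
    (hv : (minpoly K v).natDegree = m)
    (hs : Module.finrank F E = 2 * s) (hs1 : 1 ≤ s) (χ : MulChar F ℂ) (hχ : χ ≠ 1)
    (hχK : ∀ a : K, a ≠ 0 → χ (algebraMap K F a) = 1) (T : ℕ)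
    (hT : T = ∑ j ∈ Finset.range m, Fintype.card K ^ j) :
    ‖LS (lam K v χ) (m * (2 * s))‖ ≤
      ((T : ℝ) * (T + 3) * Fintype.card F + m) * (Fintype.card K : ℝ) ^ (m * s) := by
  classical
  obtain ⟨T', M, hT', hTF, hTM, hcount⟩ := Yfun_count (K := K) (E := E) v m s hm hm2 hv hs hs1
  have hTT : T' = T := by rw [hT', hT]
  subst hTT
  have hfin : Module.finrank K E = m * (2 * s) := by rw [← hm, ← hs, Module.finrank_mul_finrank]
  rw [← hfin, LS_eq (E := E)]
  have hb := char_sum_bound χ hχ hχK (Yfun K v : E → F) T' M m hTF hcount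
    (Yfun_zero_card (K := K) v m hm hv)
  refine le_trans (b := _) hb ?_
  have hcF : Fintype.card F = Fintype.card K ^ m := by rw [← hm]; exact Module.card_eq_pow_finrank
  have hTM' : (T' : ℝ) * M ≤ Fintype.card E + T' * (T' + 3) * Fintype.card F ^ (s + 1) := by
    exact_mod_cast hTM
  have hpow : (Fintype.card K : ℝ) ^ (m * s) = (Fintype.card F : ℝ) ^ s := by
    rw [hcF]; push_cast; rw [pow_mul]
  rw [hpow]
  have h1 : (1 : ℝ) ≤ (Fintype.card F : ℝ) ^ s := by
    apply one_le_pow₀; exact_mod_cast Fintype.card_pos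
  have h2 : (m : ℝ) ≤ m * (Fintype.card F : ℝ) ^ s := le_mul_of_one_le_right (by positivity) h1
  have h3 : ((T' : ℝ) * (T' + 3) * Fintype.card F + m) * (Fintype.card F : ℝ) ^ s =
    T' * (T' + 3) * Fintype.card F ^ (s + 1) + m * (Fintype.card F : ℝ) ^ s := by ring
  rw [h3]
  linarith

end Katz4

section Katz5
variable {K F : Type*} [Field K] [Fintype K] [Field F] [Fintype F] [Algebra K F]

lemma LA_one (v : F) (χ : MulChar F ℂ) :
    LA (lam K v χ) 1 = ∑ a : K, χ (v - algebraMap K F a) := by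
  rw [LA]
  symm
  refine Finset.sum_bij (fun a _ => X - C a) ?_ ?_ ?_ ?_
  · intro a _
    exact mem_Mon.2 ⟨monic_X_sub_C a, natDegree_X_sub_C a⟩
  · intro a _ b _ h
    simpa using h
  · intro f hf
    obtain ⟨h1, h2⟩ := mem_Mon.1 hf
    refine ⟨-f.coeff 0, Finset.mem_univ _, ?_⟩
    rw [h1.eq_X_add_C h2]; simp
  · intro a _
    rw [lam_apply]; simp

lemma katz (v : F) (χ : MulChar F ℂ) (hχ : χ ≠ 1)
    (hχK : ∀ a : K, a ≠ 0 → χ (algebraMap K F a) = 1)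
    (hv : (minpoly K v).natDegree = Module.finrank K F) (hm2 : 2 ≤ Module.finrank K F) :
    ‖∑ a : K, χ (v - algebraMap K F a)‖ ≤
      ((Module.finrank K F - 1 : ℕ) : ℝ) * Real.sqrt (Fintype.card K) := by
  rw [← LA_one]
  obtain ⟨p, hp⟩ := CharP.exists F
  have hpp : Fact p.Prime := ⟨CharP.char_is_prime F p⟩
  refine weil_of_bound (Module.finrank K F - 1) (Module.finrank K F) (by omega) (Fintype.card K)
    Fintype.card_pos (LA (lam K v χ)) (LS (lam K v χ)) (LA_zero _)
    (fun k hk => LA_lam_zero v χ hχ hv k (by omega)) (LA_rec _)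
    (((∑ j ∈ Finset.range (Module.finrank K F), Fintype.card K ^ j : ℕ) : ℝ) *
      ((∑ j ∈ Finset.range (Module.finrank K F), Fintype.card K ^ j : ℕ) + 3) *
      Fintype.card F + Module.finrank K F) ?_
  intro s hs
  have : NeZero (2 * s) := ⟨by omega⟩
  let E := FiniteField.Extension F p (2 * s)
  let _ : Fintype E := Fintype.ofFinite E
  let _ : Algebra K E := ((algebraMap F E).comp (algebraMap K F)).toAlgebra
  have : IsScalarTower K F E := IsScalarTower.of_algebraMap_eq' rfl
  exact LS_bound (E := E) v _ s rfl hm2 hv (FiniteField.finrank_extension F p (2 * s)) hs χ hχ hχK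
    _ rfl

end Katz5



end Helpers
section Peisert

lemma sin_lower (d : ℕ) (hd : 4 ≤ d) : Real.pi * ((d : ℝ) - 1) / (d : ℝ) ^ 2 < Real.sin (Real.pi / d) := by
  have hdR : (4 : ℝ) ≤ d := by exact_mod_cast hd
  have hpi := Real.pi_pos
  have hx : 0 < Real.pi / d := by positivity
  refine lt_of_le_of_lt ?_ (Real.sin_gt_sub_cube hx)
  have h1 : Real.pi * ((d : ℝ) - 1) / (d : ℝ) ^ 2 = Real.pi / d - Real.pi / d * (1 / d) := by
    field_simp
  rw [h1]
  have h2 : (Real.pi / d) ^ 3 / 6 = Real.pi / d * (1 / d) * (Real.pi ^ 2 / (6 * d)) := by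
    field_simp
  rw [h2]
  have h3 : Real.pi ^ 2 / (6 * d) ≤ 1 := by
    rw [div_le_one (by positivity)]
    nlinarith [Real.pi_lt_four]
  have : 0 ≤ Real.pi / d * (1 / d) := by positivity
  nlinarith

lemma sin_odd (d j : ℕ) (hd : 4 ≤ d) (hj : 2 * j + 2 ≤ d) :
    Real.sin (Real.pi / d) ≤ Real.sin ((2 * j + 1) * (Real.pi / d)) := by
  have hdR : (4 : ℝ) ≤ d := by exact_mod_cast hd
  have hjR : (2 : ℝ) * j + 2 ≤ d := by exact_mod_cast hj
  have hj0 : (0 : ℝ) ≤ j := by positivity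
  have hpi := Real.pi_pos
  have hx : 0 < Real.pi / d := by positivity
  have hdx : (d : ℝ) * (Real.pi / d) = Real.pi := by field_simp
  set x := Real.pi / d with hxdef
  rcases le_total ((2 * j + 1) * x) (Real.pi / 2) with h | h
  · exact Real.sin_le_sin_of_le_of_le_pi_div_two (by linarith) h (by nlinarith)
  · rw [← Real.sin_pi_sub ((2 * j + 1) * x)]
    exact Real.sin_le_sin_of_le_of_le_pi_div_two (by linarith) (by linarith) (by nlinarith)

lemma re_lower (d j : ℕ) (hd : 4 ≤ d) (hj : 2 * j + 2 ≤ d) :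
    Real.sin (Real.pi / d) ≤ (Complex.exp (2 * Real.pi * Complex.I / d) ^ j *
      Complex.exp (((Real.pi / d - Real.pi / 2 : ℝ) : ℂ) * Complex.I)).re := by
  refine (sin_odd d j hd hj).trans (le_of_eq ?_)
  have hd0 : (d : ℂ) ≠ 0 := by exact_mod_cast (by omega : d ≠ 0)
  have : Complex.exp (2 * Real.pi * Complex.I / d) ^ j *
      Complex.exp (((Real.pi / d - Real.pi / 2 : ℝ) : ℂ) * Complex.I) =
      Complex.exp ((((2 * j + 1) * (Real.pi / d) - Real.pi / 2 : ℝ) : ℂ) * Complex.I) := by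
    rw [← Complex.exp_nat_mul, ← Complex.exp_add]
    congr 1
    push_cast
    field_simp
    ring
  rw [this, Complex.exp_ofReal_mul_I_re, Real.cos_sub_pi_div_two]

noncomputable def resChar {F : Type*} [Field F] {K : Type*} [Field K] [Algebra K F]
    (F0 : IntermediateField K F) (χ : MulChar F ℂ) : MulChar F0 ℂ where
  toFun x := χ (x : F)
  map_one' := by simp
  map_mul' x y := by simp
  map_nonunit' x hx := by
    have : x = 0 := by
      by_contra h; exact hx (isUnit_iff_ne_zero.2 h)
    simp [this, MulChar.map_zero]

lemma resChar_apply {F : Type*} [Field F] {K : Type*} [Field K] [Algebra K F]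
    (F0 : IntermediateField K F) (χ : MulChar F ℂ) (x : F0) : resChar F0 χ x = χ (x : F) := rfl

lemma katz_sub {F K : Type*} [Field F] [Fintype F] [Field K] [Fintype K] [Algebra K F]
    (χ : MulChar F ℂ) (v : F)
    (hχK : ∀ a : K, a ≠ 0 → χ (algebraMap K F a) = 1)
    (hv : v ∉ Set.range (algebraMap K F))
    (hχ : ∃ x ∈ IntermediateField.adjoin K {v}, x ≠ 0 ∧ χ x ≠ 1) :
    ‖∑ a : K, χ (v - algebraMap K F a)‖ ≤
      ((Module.finrank K F : ℝ) - 1) * Real.sqrt (Fintype.card K) := by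
  classical
  set F0 := IntermediateField.adjoin K {v} with hF0
  let _ : Fintype F0 := Fintype.ofFinite F0
  have hIntg : IsIntegral K v := IsIntegral.of_finite K v
  have hfin : Module.finrank K F0 = (minpoly K v).natDegree := IntermediateField.adjoin.finrank hIntg
  let v0 : F0 := ⟨v, IntermediateField.mem_adjoin_simple_self K v⟩
  have hmin : minpoly K v0 = minpoly K v := (minpoly.algebraMap_eq (A := K) (algebraMap F0 F).injective v0).symm
  have hpos := minpoly.natDegree_pos hIntg
  have hm2 : 2 ≤ Module.finrank K F0 := by
    rw [hfin]
    have : (minpoly K v).natDegree ≠ 1 := fun h => hv (minpoly.natDegree_eq_one_iff.1 h)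
    omega
  have hb := katz (K := K) v0 (resChar F0 χ)
    (by
      intro h
      obtain ⟨x, hx, hx0, hx1⟩ := hχ
      have h1 := DFunLike.congr_fun h (⟨x, hx⟩ : F0)
      rw [resChar_apply, MulChar.one_apply] at h1
      · exact hx1 h1
      · exact isUnit_iff_ne_zero.2 (fun h => hx0 (congrArg Subtype.val h)))
    (fun a ha => hχK a ha) (by rw [hmin, hfin]) hm2
  have hle : Module.finrank K F0 ≤ Module.finrank K F := Nat.le_of_dvd Module.finrank_pos
    ⟨Module.finrank F0 F, (Module.finrank_mul_finrank K F0 F).symm⟩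
  refine le_trans hb (mul_le_mul_of_nonneg_right ?_ (Real.sqrt_nonneg _))
  rw [Nat.cast_sub (by omega), Nat.cast_one]
  have : (Module.finrank K F0 : ℝ) ≤ Module.finrank K F := by exact_mod_cast hle
  linarith

end Peisert


/-- Theorem 1.4 / `main2`: Let `d ≥ 4` be even, `q` a power of an odd
prime, `n ≥ 2` with `q ^ n ≡ 1 (mod 2d)` and `q > (n-1)^2 d^4 / (π^2 (d-1)^2)`.  If the
subfield `𝔽_q` of `𝔽_{q^n}` is a maximal subfield clique in the generalized Peisert
graph `GP*(q^n, d)`, then `𝔽_q` is a maximal clique in `GP*(q^n, d)`. -/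
theorem subfield_maximal_clique_in_generalized_Peisert
    (p q d n kp : ℕ) (hp : p.Prime) (hpodd : Odd p) (hkp : 1 ≤ kp) (hq : q = p ^ kp)
    (hd : 4 ≤ d) (hdeven : Even d) (hn : 2 ≤ n)
    (hmod : q ^ n ≡ 1 [MOD 2 * d])
    (hqbig : ((n : ℝ) - 1) ^ 2 * (d : ℝ) ^ 4 / (Real.pi ^ 2 * ((d : ℝ) - 1) ^ 2) < q)
    (F : Type*) [Field F] [Fintype F] (hF : Fintype.card F = q ^ n)
    (g : Fˣ) (hg : Subgroup.zpowers g = ⊤)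
    (S : Set F)
    (hS : S = {x : F | ∃ j : ℕ, j ≤ d / 2 - 1 ∧
      ∃ k : ℤ, x = ((g ^ ((d : ℤ) * k + (j : ℤ)) : Fˣ) : F)})
    (K : Subfield F) (hK : Nat.card K = q)
    (G : SimpleGraph F)
    (hG : ∀ x y : F, G.Adj x y ↔ x ≠ y ∧ x - y ∈ S)
    (hclique : G.IsClique (K : Set F))
    (hmaxsub : ∀ K' : Subfield F, (K : Set F) ⊆ (K' : Set F) →
      G.IsClique (K' : Set F) → K' = K) :
    ∀ C : Set F, (K : Set F) ⊆ C → G.IsClique C → C = (K : Set F) := by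
  intro C hKC hC
  refine Set.Subset.antisymm ?_ hKC
  intro v hvC
  by_contra hvK
  classical
  have hq0 : 0 < q := by rw [hq]; exact pow_pos hp.pos _
  have hdd : d ∣ Fintype.card Fˣ := by
    rw [Fintype.card_units, hF]
    have h1 := (Nat.modEq_iff_dvd' (Nat.one_le_pow _ _ hq0)).1 hmod.symm
    exact (Dvd.intro_left 2 rfl).trans h1
  have hd0 : d ≠ 0 := by omega
  set ζ : ℂ := Complex.exp (2 * Real.pi * Complex.I / d) with hζ
  have hprim : IsPrimitiveRoot ζ d := Complex.isPrimitiveRoot_exp d hd0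
  have hζ0 : ζ ≠ 0 := Complex.exp_ne_zero _
  have hroot : Units.mk0 ζ hζ0 ∈ rootsOfUnity (Fintype.card Fˣ) ℂ := by
    rw [mem_rootsOfUnity]
    ext
    rw [Units.val_pow_eq_pow_val, Units.val_mk0, Units.val_one]
    exact (hprim.pow_eq_one_iff_dvd _).2 hdd
  have hg' : ∀ x, x ∈ Subgroup.zpowers g := fun x => by rw [hg]; trivial
  let χ : MulChar F ℂ := MulChar.ofRootOfUnity hroot hg'
  have hχg : χ (g : F) = ζ := MulChar.ofRootOfUnity_spec hroot hg'
  have hχz : ∀ z : ℤ, χ ((g ^ z : Fˣ) : F) = ζ ^ z := by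
    intro z
    rw [← MulChar.coe_toUnitHom, map_zpow, Units.val_zpow_eq_zpow_val, MulChar.coe_toUnitHom, hχg]
  have hval : ∀ x ∈ S, ∃ j : ℕ, 2 * j + 2 ≤ d ∧ χ x = ζ ^ j := by
    intro x hx
    rw [hS] at hx
    obtain ⟨j, hj, k, rfl⟩ := hx
    refine ⟨j, by omega, ?_⟩
    rw [hχz, zpow_add₀ hζ0, zpow_mul, zpow_natCast, hprim.pow_eq_one, one_zpow, one_mul,
      zpow_natCast]
  have hone : ∀ x : F, x ≠ 0 → χ x = 1 → x ∈ S := by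
    intro x hx h1
    obtain ⟨z, hz⟩ := hg' (Units.mk0 x hx)
    have hxz : x = ((g ^ z : Fˣ) : F) := by
      have := congrArg Units.val hz
      simpa using this.symm
    rw [hxz, hχz, hprim.zpow_eq_one_iff_dvd] at h1
    obtain ⟨k, hk⟩ := h1
    rw [hS]
    refine ⟨0, by omega, k, ?_⟩
    rw [hxz, hk]; simp
  have hKS : ∀ x ∈ K, x ≠ 0 → x ∈ S := by
    intro x hx hx0
    have := hclique (show x ∈ (K : Set F) from hx) (show (0 : F) ∈ (K : Set F) from K.zero_mem) hx0
    simpa using ((hG _ _).1 this).2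
  have hχK : ∀ a : K, a ≠ 0 → χ (algebraMap K F a) = 1 := by
    intro a ha
    have ha0 : (a : F) ≠ 0 := fun h => ha (Subtype.ext h)
    obtain ⟨j, hj, h1⟩ := hval _ (hKS a a.2 ha0)
    obtain ⟨i, hi, h2⟩ := hval _ (hKS (a : F)⁻¹ (K.inv_mem a.2) (inv_ne_zero ha0))
    have h3 : ζ ^ (j + i) = 1 := by
      rw [pow_add, ← h1, ← h2, ← map_mul, mul_inv_cancel₀ ha0, map_one]
    rw [hprim.pow_eq_one_iff_dvd] at h3
    have h4 : j + i = 0 := Nat.eq_zero_of_dvd_of_lt h3 (by omega)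
    have h5 : j = 0 := by omega
    change χ (a : F) = 1
    rw [h1, h5, pow_zero]
  let _ : Fintype K := Fintype.ofFinite K
  have hcK : Fintype.card K = q := by rw [← Nat.card_eq_fintype_card]; exact hK
  have hq1 : 1 < q := by rw [← hcK]; exact Fintype.one_lt_card
  have hfin : Module.finrank K F = n := by
    have h1 : Fintype.card F = Fintype.card K ^ Module.finrank K F := Module.card_eq_pow_finrank
    rw [hF, hcK] at h1
    exact (Nat.pow_right_injective hq1 h1).symm
  have hvr : v ∉ Set.range (algebraMap K F) := by
    rintro ⟨a, rfl⟩
    exact hvK a.2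
  have hb := katz_sub (K := K) χ v hχK hvr (by
    by_contra! hcon
    have h1 := hmaxsub (IntermediateField.adjoin K {v}).toSubfield
      (fun x hx => (IntermediateField.adjoin K {v}).algebraMap_mem ⟨x, hx⟩)
      (by
        intro x hx y hy hxy
        have hmem : x - y ∈ IntermediateField.adjoin K {v} := sub_mem hx hy
        exact (hG x y).2 ⟨hxy, hone _ (sub_ne_zero.2 hxy) (hcon _ hmem (sub_ne_zero.2 hxy))⟩)
    have h2 : v ∈ (IntermediateField.adjoin K {v}).toSubfield :=
      IntermediateField.mem_adjoin_simple_self K v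
    rw [h1] at h2
    exact hvK h2)
  rw [hfin, hcK] at hb
  have hlow : (q : ℝ) * Real.sin (Real.pi / d) ≤ ‖∑ a : K, χ (v - algebraMap K F a)‖ := by
    set w : ℂ := Complex.exp (((Real.pi / d - Real.pi / 2 : ℝ) : ℂ) * Complex.I) with hw
    have hwn : ‖w‖ = 1 := Complex.norm_exp_ofReal_mul_I _
    have h1 : ‖∑ a : K, χ (v - algebraMap K F a)‖ = ‖∑ a : K, χ (v - algebraMap K F a) * w‖ := by
      rw [← Finset.sum_mul, norm_mul, hwn, mul_one]
    rw [h1]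
    refine le_trans ?_ (Complex.re_le_norm _)
    rw [Complex.re_sum]
    have h2 : (q : ℝ) * Real.sin (Real.pi / d) = ∑ _a : K, Real.sin (Real.pi / d) := by
      rw [Finset.sum_const, Finset.card_univ, hcK, nsmul_eq_mul]
    rw [h2]
    refine Finset.sum_le_sum fun a _ => ?_
    have hne : v ≠ (a : F) := fun h => hvK (h ▸ a.2)
    obtain ⟨j, hj, h3⟩ := hval _ ((hG _ _).1 (hC hvC (hKC a.2) hne)).2
    change _ ≤ (χ (v - (a : F)) * w).re
    rw [h3]
    exact re_lower d j hd hj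
  have hsl := sin_lower d hd
  have hqR : (0 : ℝ) < q := by exact_mod_cast hq0
  have hsq : Real.sqrt q * Real.sqrt q = q := Real.mul_self_sqrt hqR.le
  have hsq0 : 0 < Real.sqrt q := Real.sqrt_pos.2 hqR
  have hdR : (4 : ℝ) ≤ d := by exact_mod_cast hd
  have hnR : (2 : ℝ) ≤ n := by exact_mod_cast hn
  have hpi := Real.pi_pos
  set y := Real.pi * ((d : ℝ) - 1) / (d : ℝ) ^ 2 with hy
  have hy0 : 0 < y := div_pos (mul_pos hpi (by linarith)) (by positivity)
  have h1 : Real.sqrt q * y ≤ (n : ℝ) - 1 := by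
    have h2 : (q : ℝ) * y ≤ ((n : ℝ) - 1) * Real.sqrt q :=
      le_trans (mul_le_mul_of_nonneg_left hsl.le hqR.le) (hlow.trans hb)
    refine le_of_mul_le_mul_right ?_ hsq0
    calc Real.sqrt q * y * Real.sqrt q = (Real.sqrt q * Real.sqrt q) * y := by ring
      _ = q * y := by rw [hsq]
      _ ≤ _ := h2
  have h2 : (q : ℝ) * y ^ 2 ≤ ((n : ℝ) - 1) ^ 2 := by
    calc (q : ℝ) * y ^ 2 = (Real.sqrt q * y) ^ 2 := by rw [mul_pow, sq (Real.sqrt q), hsq]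
      _ ≤ _ := pow_le_pow_left₀ (by positivity) h1 2
  have h3 : ((n : ℝ) - 1) ^ 2 * (d : ℝ) ^ 4 / (Real.pi ^ 2 * ((d : ℝ) - 1) ^ 2) =
      ((n : ℝ) - 1) ^ 2 / y ^ 2 := by
    have : (d : ℝ) - 1 ≠ 0 := by linarith
    rw [hy]
    field_simp
  rw [h3, div_lt_iff₀ (by positivity)] at hqbig
  linarith
end

section
/- Let $d > 1$ be an integer, $q$ a prime power, and $n \geq 1$ an integer with $q^n \equiv 1 \pmod{2d}$ and $d \mid \frac{q^n-1}{q-1}$. Then the clique number of the generalized Paley graph satisfies $\omega(GP(q^n, d)) \geq q$. -/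
/-- if `d ∣ (q^n - 1)/(q - 1)` (and `q^n ≡ 1 (mod 2d)`), then the
clique number of the generalized Paley graph `GP(q^n, d)` is at least `q`. -/
theorem cliqueNum_generalized_Paley_ge
    (p q d n kp : ℕ) (hp : p.Prime) (hkp : 1 ≤ kp) (hq : q = p ^ kp)
    (hd : 1 < d) (hn : 1 ≤ n)
    (hmod : q ^ n ≡ 1 [MOD 2 * d]) (hdvd : d ∣ (q ^ n - 1) / (q - 1))
    (F : Type*) [Field F] [Fintype F] (hF : Fintype.card F = q ^ n)
    (G : SimpleGraph F)
    (hG : ∀ x y : F, G.Adj x y ↔ x ≠ y ∧ ∃ z : F, z ≠ 0 ∧ x - y = z ^ d) :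
    q ≤ G.cliqueNum := by
  classical
  haveI : Fact p.Prime := ⟨hp⟩
  have hq2 : 2 ≤ q := by
    rw [hq]
    exact hp.two_le.trans (Nat.le_self_pow (by omega) p)
  haveI : CharP F p := by
    apply charP_of_card_eq_prime_pow (f := kp * n)
    rw [← Nat.card_eq_fintype_card] at hF
    simpa [hq, ← pow_mul] using hF
  obtain ⟨g, hg⟩ := IsCyclic.exists_generator (α := Fˣ)
  have hord : orderOf g = q ^ n - 1 := by
    rw [orderOf_eq_card_of_forall_mem_zpowers hg, Nat.card_eq_fintype_card,
      Fintype.card_units, hF]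
  obtain ⟨m, hm⟩ : q - 1 ∣ q ^ n - 1 := by
    simpa using Nat.sub_dvd_pow_sub_pow q 1 n
  have hmd : d ∣ m := by
    rwa [hm, Nat.mul_div_cancel_left _ (by omega)] at hdvd
  have hpos : 0 < q ^ n - 1 := by
    have : 2 ≤ q ^ n := hq2.trans (Nat.le_self_pow (by omega) q)
    omega
  have hm0 : 0 < m := by
    rcases Nat.eq_zero_or_pos m with h | h
    · simp [h] at hm; omega
    · exact h
  have hordm : orderOf (g ^ m) = q - 1 := by
    rw [orderOf_pow_of_dvd hm0.ne' (by rw [hord, hm]; exact Dvd.intro_left _ rfl), hord, hm,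
      Nat.mul_div_cancel _ hm0]
  let T : Finset F := insert 0 ((Finset.range (q - 1)).image fun i => (((g ^ m) ^ i : Fˣ) : F))
  have hcard : T.card = q := by
    rw [Finset.card_insert_of_notMem, Finset.card_image_of_injOn, Finset.card_range]
    · omega
    · intro i hi j hj hij
      have h := Units.ext hij
      apply pow_injOn_Iio_orderOf (x := g ^ m) _ _ h
      · simpa [hordm] using hi
      · simpa [hordm] using hj
    · simp
  have hT : ∀ x ∈ T, x ^ q = x := by
    intro x hx
    rcases Finset.mem_insert.1 hx with rfl | hx
    · exact zero_pow (by omega)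
    · obtain ⟨i, -, rfl⟩ := Finset.mem_image.1 hx
      rw [← Units.val_pow_eq_pow_val]
      congr 1
      obtain ⟨r, rfl⟩ : ∃ r, q = r + 1 := ⟨q - 1, by omega⟩
      have h1 : (g ^ m) ^ r = 1 := by
        rw [← orderOf_dvd_iff_pow_eq_one, hordm]; simp
      rw [pow_succ, ← pow_mul, mul_comm, mul_comm i r, pow_mul, h1, one_pow, mul_one]
  have hcl : G.IsClique T := by
    intro x hx y hy hxy
    rw [hG]
    refine ⟨hxy, ?_⟩
    have hne : x - y ≠ 0 := sub_ne_zero.2 hxy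
    have h1 : (x - y) ^ q = x - y := by
      conv_rhs => rw [← hT x hx, ← hT y hy]
      rw [hq, sub_pow_char_pow]
    obtain ⟨i, hi⟩ := (mem_powers_iff_mem_zpowers (x := g)).2 (hg (Units.mk0 _ hne))
    have hi : g ^ i = Units.mk0 _ hne := hi
    have h2 : (Units.mk0 _ hne) ^ (q - 1) = 1 := by
      apply Units.ext
      obtain ⟨r, rfl⟩ : ∃ r, q = r + 1 := ⟨q - 1, by omega⟩
      rw [pow_succ] at h1
      simpa using mul_right_cancel₀ hne (h1.trans (one_mul _).symm)
    rw [← hi, ← pow_mul, ← orderOf_dvd_iff_pow_eq_one, hord, hm, mul_comm i] at h2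
    obtain ⟨k, rfl⟩ := hmd.trans (Nat.dvd_of_mul_dvd_mul_left (by omega) h2)
    refine ⟨((g ^ k : Fˣ) : F), Units.ne_zero _, ?_⟩
    have h3 := congrArg Units.val hi
    rw [mul_comm, pow_mul] at h3
    simpa using h3.symm
  rw [← hcard]
  exact hcl.card_le_cliqueNum
end
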